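/- With Γ = SL(3,ℚ) *_Σ SL(3,K) and Λ = Λ₁ * Λ₂ as in the context, for α ∈ Aut(K) let θ_α denote the automorphism of Γ that restricts to the identity on Γ₁ = SL(3,ℚ) and to entrywise application of α on Γ₂ = SL(3,K) (well-defined since α fixes ℚ pointwise, hence fixes Σ pointwise). Then the map Λ × Aut(K) → Aut(Γ) sending (λ, α) to Ad(λ) ∘ θ_α is an injective group homomorphism whose image is exactly the group Aut(Λ < Γ) := { δ ∈ Aut(Γ) : δ(Λ) = Λ }. In particular, Aut(Λ < Γ) ≅ Λ × Aut(K). -/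

import Mathlib

open Matrix

/-- The matrix `A = [[1,0,0],[1,q,0],[1,0,q⁻¹]]` as an element of `SL(3,F)`. -/
def AmatSL (F : Type) [Field F] [CharZero F] (q : ℚ) (hq : q ≠ 0) :
    Matrix.SpecialLinearGroup (Fin 3) F :=
  ⟨!![1, 0, 0; 1, (q : F), 0; 1, 0, (q : F)⁻¹], by
    have hq' : (q : F) ≠ 0 := by exact_mod_cast hq
    simp [Matrix.det_fin_three, Matrix.vecHead, Matrix.vecTail]
    field_simp⟩

/-- The upper unitriangular matrix `[[1,a,b],[0,1,c],[0,0,1]]` with integer entries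
as an element of `SL(3,F)`. -/
def unitriSL (F : Type) [Field F] (a b c : ℤ) : Matrix.SpecialLinearGroup (Fin 3) F :=
  ⟨!![1, (a : F), (b : F); 0, 1, (c : F); 0, 0, 1], by simp [Matrix.det_fin_three, Matrix.vecHead, Matrix.vecTail]⟩

lemma unitriSL_mul (F : Type) [Field F] (a b c a' b' c' : ℤ) :
    unitriSL F a b c * unitriSL F a' b' c'
      = unitriSL F (a + a') (b + b' + a * c') (c + c') := by
  apply Subtype.ext
  show (unitriSL F a b c).val * (unitriSL F a' b' c').val = _
  ext i j
  fin_cases i <;> fin_cases j <;>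
    simp [unitriSL, Matrix.mul_apply, Fin.sum_univ_three, Matrix.vecHead, Matrix.vecTail] <;> push_cast <;> ring

/-- The group `Λᵢ` of upper unitriangular matrices with integer entries,
as a subgroup of `SL(3,F)`. -/
def unitriSubgroup (F : Type) [Field F] : Subgroup (Matrix.SpecialLinearGroup (Fin 3) F) where
  carrier := {M | ∃ a b c : ℤ, M = unitriSL F a b c}
  one_mem' := ⟨0, 0, 0, by
    apply Subtype.ext
    show (1 : Matrix (Fin 3) (Fin 3) F) = _
    ext i j
    fin_cases i <;> fin_cases j <;> simp [unitriSL, Matrix.vecHead, Matrix.vecTail]⟩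
  mul_mem' := by
    rintro _ _ ⟨a, b, c, rfl⟩ ⟨a', b', c', rfl⟩
    exact ⟨a + a', b + b' + a * c', c + c', (unitriSL_mul F a b c a' b' c').symm ▸ rfl⟩
  inv_mem' := by
    rintro _ ⟨a, b, c, rfl⟩
    refine ⟨-a, a * c - b, -c, ?_⟩
    rw [inv_eq_iff_mul_eq_one, unitriSL_mul]
    apply Subtype.ext
    show (unitriSL F _ _ _).val = (1 : Matrix (Fin 3) (Fin 3) F)
    ext i j
    fin_cases i <;> fin_cases j <;> simp [unitriSL, Matrix.vecHead, Matrix.vecTail] <;> push_cast <;> ring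

/-- The pair of factors `Γ₁ = SL(3,ℚ)` (index `false`) and `Γ₂ = SL(3,K)` (index `true`). -/
def SLfam (K : Type) [Field K] : Bool → Type
  | false => Matrix.SpecialLinearGroup (Fin 3) ℚ
  | true => Matrix.SpecialLinearGroup (Fin 3) K

instance (K : Type) [Field K] : (i : Bool) → Group (SLfam K i)
  | false => inferInstanceAs (Group (Matrix.SpecialLinearGroup (Fin 3) ℚ))
  | true => inferInstanceAs (Group (Matrix.SpecialLinearGroup (Fin 3) K))

/-- The element `A`, in each of the two factors. -/
def AmatFam (K : Type) [Field K] [CharZero K] (q : ℚ) (hq : q ≠ 0) :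
    (i : Bool) → SLfam K i
  | false => AmatSL ℚ q hq
  | true => AmatSL K q hq

/-- The embeddings of `Σ = ℤ` into the two factors, sending the generator to `A`. -/
def sigmaMaps (K : Type) [Field K] [CharZero K] (q : ℚ) (hq : q ≠ 0) :
    (i : Bool) → Multiplicative ℤ →* SLfam K i :=
  fun i => zpowersHom (SLfam K i) (AmatFam K q hq i)

/-- The amalgamated free product `Γ = SL(3,ℚ) *_Σ SL(3,K)`. -/
abbrev AmalGamma (K : Type) [Field K] [CharZero K] (q : ℚ) (hq : q ≠ 0) : Type :=
  Monoid.PushoutI (sigmaMaps K q hq)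

/-- The canonical embeddings `Γᵢ → Γ`. -/
def amalInc (K : Type) [Field K] [CharZero K] (q : ℚ) (hq : q ≠ 0) (i : Bool) :
    SLfam K i →* AmalGamma K q hq :=
  Monoid.PushoutI.of (φ := sigmaMaps K q hq) i

/-- The subgroup of `Γᵢ` corresponding to `Λᵢ`, the integer unitriangular matrices. -/
def unitriFam (K : Type) [Field K] : (i : Bool) → Subgroup (SLfam K i)
  | false => unitriSubgroup ℚ
  | true => unitriSubgroup K

/-- The subgroup `Λ = Λ₁ * Λ₂` of `Γ` generated by the images of `Λ₁` and `Λ₂`. -/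
def amalLambda (K : Type) [Field K] [CharZero K] (q : ℚ) (hq : q ≠ 0) :
    Subgroup (AmalGamma K q hq) :=
  ((unitriFam K false).map (amalInc K q hq false)) ⊔ ((unitriFam K true).map (amalInc K q hq true))

/-- The subgroup `Σ = {Aᵏ} ≤ Γ` (the common image of the two copies of `Σ`). -/
def amalSigma (K : Type) [Field K] [CharZero K] (q : ℚ) (hq : q ≠ 0) :
    Subgroup (AmalGamma K q hq) :=
  Subgroup.zpowers (amalInc K q hq false (AmatFam K q hq false))

section ReducedWords

variable {G : Type*} [Group G] {H : Bool → Subgroup G} {T : Subgroup G}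

/-- A word whose letters lie alternately in `H false` and `H true`, and never in `T`. -/
def IsReducedWord (H : Bool → Subgroup G) (T : Subgroup G) (l : List (Bool × G)) : Prop :=
  l.IsChain (fun a b => a.1 ≠ b.1) ∧ ∀ p ∈ l, p.2 ∈ H p.1 ∧ p.2 ∉ T

/-- The product of the letters of a word. -/
def letterProd (l : List (Bool × G)) : G := (l.map Prod.snd).prod

/-- The word spelling the inverse of a word. -/
def invWord (l : List (Bool × G)) : List (Bool × G) := (l.map fun p => (p.1, p.2⁻¹)).reverse

@[simp] lemma letterProd_nil : letterProd ([] : List (Bool × G)) = 1 := rfl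

@[simp] lemma letterProd_cons (p : Bool × G) (l : List (Bool × G)) :
    letterProd (p :: l) = p.2 * letterProd l := by simp [letterProd]

@[simp] lemma letterProd_append (l l' : List (Bool × G)) :
    letterProd (l ++ l') = letterProd l * letterProd l' := by simp [letterProd]

@[simp] lemma letterProd_invWord (l : List (Bool × G)) :
    letterProd (invWord l) = (letterProd l)⁻¹ := by
  induction l with
  | nil => simp [invWord]
  | cons p l ih =>
    have : invWord (p :: l) = invWord l ++ [(p.1, p.2⁻¹)] := by simp [invWord]
    rw [this, letterProd_append, ih]
    simp

lemma IsReducedWord.nil : IsReducedWord H T [] := ⟨by simp, by simp⟩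

lemma IsReducedWord.singleton {i : Bool} {a : G} (ha : a ∈ H i) (haT : a ∉ T) :
    IsReducedWord H T [(i, a)] := ⟨by simp, by simp [ha, haT]⟩

lemma IsReducedWord.of_cons {p : Bool × G} {l : List (Bool × G)}
    (h : IsReducedWord H T (p :: l)) : IsReducedWord H T l :=
  ⟨h.1.tail, fun q hq => h.2 q (List.mem_cons_of_mem _ hq)⟩

lemma IsReducedWord.append {l l' : List (Bool × G)} (h : IsReducedWord H T l)
    (h' : IsReducedWord H T l') (hij : ∀ p ∈ l.getLast?, ∀ q ∈ l'.head?, p.1 ≠ q.1) :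
    IsReducedWord H T (l ++ l') :=
  ⟨h.1.append h'.1 hij, fun p hp => (List.mem_append.1 hp).elim (h.2 p) (h'.2 p)⟩

lemma IsReducedWord.left {l l' : List (Bool × G)} (h : IsReducedWord H T (l ++ l')) :
    IsReducedWord H T l :=
  ⟨(List.isChain_append.1 h.1).1, fun p hp => h.2 p (List.mem_append_left _ hp)⟩

lemma IsReducedWord.right {l l' : List (Bool × G)} (h : IsReducedWord H T (l ++ l')) :
    IsReducedWord H T l' :=
  ⟨(List.isChain_append.1 h.1).2.1, fun p hp => h.2 p (List.mem_append_right _ hp)⟩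

lemma IsReducedWord.cons {i : Bool} {a : G} {l : List (Bool × G)} (h : IsReducedWord H T l)
    (ha : a ∈ H i) (haT : a ∉ T) (hi : ∀ q ∈ l.head?, i ≠ q.1) :
    IsReducedWord H T ((i, a) :: l) :=
  (IsReducedWord.singleton ha haT).append h (by simpa using hi)

lemma IsReducedWord.invWord {l : List (Bool × G)} (h : IsReducedWord H T l) :
    IsReducedWord H T (invWord l) := by
  refine ⟨?_, ?_⟩
  · rw [_root_.invWord, List.isChain_reverse, List.isChain_map]
    exact h.1.imp fun _ _ hab => hab.symm
  · intro p hp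
    simp only [_root_.invWord, List.mem_reverse, List.mem_map] at hp
    obtain ⟨q, hq, rfl⟩ := hp
    have := h.2 q hq
    exact ⟨inv_mem this.1, by simpa using this.2⟩

lemma head?_invWord (l : List (Bool × G)) :
    (invWord l).head? = l.getLast?.map fun p => (p.1, p.2⁻¹) := by
  simp [invWord]

lemma getLast?_invWord (l : List (Bool × G)) :
    (invWord l).getLast? = l.head?.map fun p => (p.1, p.2⁻¹) := by
  simp [invWord]

lemma length_invWord (l : List (Bool × G)) : (invWord l).length = l.length := by simp [invWord]

lemma IsReducedWord.exists_mul (hT : ∀ i, T ≤ H i) {l : List (Bool × G)}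
    (hl : IsReducedWord H T l) {k : Bool} {a : G} (ha : a ∈ H k) :
    (a * letterProd l ∈ T ∧ l.length ≤ 1) ∨
      ∃ l', IsReducedWord H T l' ∧ letterProd l' = a * letterProd l ∧
        l.length ≤ l'.length + 1 := by
  rcases l with _ | ⟨⟨m, b⟩, r⟩
  · by_cases haT : a ∈ T
    · left; simpa using haT
    · right; exact ⟨_, IsReducedWord.singleton ha haT, by simp, by simp⟩
  have hb := hl.2 (m, b) (by simp)
  have hr := hl.of_cons
  have hhead : ∀ q ∈ r.head?, m ≠ q.1 := (List.isChain_cons.1 hl.1).1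
  by_cases hkm : k = m
  · subst hkm
    by_cases habT : a * b ∈ T
    · rcases r with _ | ⟨⟨m', b'⟩, r'⟩
      · left; simpa using habT
      · right
        have hb' := hr.2 (m', b') (by simp)
        refine ⟨(m', a * b * b') :: r', hr.of_cons.cons (mul_mem (hT _ habT) hb'.1) ?_
          (List.isChain_cons.1 hr.1).1, by simp [mul_assoc], by simp⟩
        exact fun h => hb'.2 ((mul_mem_cancel_left habT).1 h)
    · right
      exact ⟨(k, a * b) :: r, hr.cons (mul_mem ha hb.1) habT hhead, by simp [mul_assoc], by simp⟩
  · right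
    by_cases haT : a ∈ T
    · exact ⟨(m, a * b) :: r, hr.cons (mul_mem (hT _ haT) hb.1)
        (fun h => hb.2 ((mul_mem_cancel_left haT).1 h)) hhead, by simp [mul_assoc], by simp⟩
    · refine ⟨(k, a) :: (m, b) :: r, hl.cons ha haT (by simpa using hkm), by simp, ?_⟩
      simp only [List.length_cons]
      omega

lemma exists_letterProd_eq_of_mem_sup {x : G} (hx : x ∈ H false ⊔ H true) :
    ∃ l : List (Bool × G), (∀ p ∈ l, p.2 ∈ H p.1) ∧ letterProd l = x := by
  rw [Subgroup.sup_eq_closure] at hx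
  induction hx using Subgroup.closure_induction with
  | mem x hx =>
    rcases hx with hx | hx
    · exact ⟨[(false, x)], by simpa using hx, by simp⟩
    · exact ⟨[(true, x)], by simpa using hx, by simp⟩
  | one => exact ⟨[], by simp, rfl⟩
  | mul x y _ _ hx hy =>
    obtain ⟨l, hl, rfl⟩ := hx
    obtain ⟨l', hl', rfl⟩ := hy
    exact ⟨l ++ l', fun p hp => (List.mem_append.1 hp).elim (hl p) (hl' p), by simp⟩
  | inv x _ hx =>
    obtain ⟨l, hl, rfl⟩ := hx
    refine ⟨invWord l, fun p hp => ?_, by simp⟩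
    simp only [invWord, List.mem_reverse, List.mem_map] at hp
    obtain ⟨q, hq, rfl⟩ := hp
    exact inv_mem (hl q hq)

lemma exists_isReducedWord_of_mem_sup (hT : ∀ i, T ≤ H i) {x : G} (hx : x ∈ H false ⊔ H true) :
    x ∈ T ∨ ∃ l, IsReducedWord H T l ∧ letterProd l = x := by
  obtain ⟨l, hl, rfl⟩ := exists_letterProd_eq_of_mem_sup hx
  clear hx
  induction l with
  | nil => left; simp
  | cons p l ih =>
    have hp := hl p (by simp)
    rw [letterProd_cons]
    rcases ih fun q hq => hl q (List.mem_cons_of_mem _ hq) with h | ⟨l', hl', h⟩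
    · by_cases hpT : p.2 * letterProd l ∈ T
      · exact Or.inl hpT
      · exact Or.inr ⟨[(p.1, p.2 * letterProd l)],
          IsReducedWord.singleton (mul_mem hp (hT _ h)) hpT, by simp⟩
    · rw [← h]
      rcases hl'.exists_mul hT hp with h' | ⟨l'', h1, h2, -⟩
      · exact Or.inl h'.1
      · exact Or.inr ⟨l'', h1, h2⟩

/-- Every element of a group generated by `H false` and `H true`, of trivial base, is conjugate
into one of them or to the product of a cyclically reduced word. -/
lemma IsReducedWord.exists_conj {l : List (Bool × G)} (hl : IsReducedWord H ⊥ l) :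
    ∃ g ∈ H false ⊔ H true, (∃ i, g * letterProd l * g⁻¹ ∈ H i) ∨
      ∃ l', IsReducedWord H ⊥ l' ∧ l' ≠ [] ∧ letterProd l' = g * letterProd l * g⁻¹ ∧
        ∀ p ∈ l'.getLast?, ∀ q ∈ l'.head?, p.1 ≠ q.1 := by
  induction hn : l.length using Nat.strong_induction_on generalizing l with
  | _ n ih =>
  rcases l with _ | ⟨⟨i, a⟩, r⟩
  · exact ⟨1, one_mem _, Or.inl ⟨true, by simp⟩⟩
  rcases r.eq_nil_or_concat' with rfl | ⟨r, ⟨j, b⟩, rfl⟩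
  · exact ⟨1, one_mem _, Or.inl ⟨i, by simpa using (hl.2 (i, a) (by simp)).1⟩⟩
  have ha := (hl.2 (i, a) (by simp)).1
  have hb := (hl.2 (j, b) (by simp)).1
  by_cases hij : i = j
  · subst hij
    have hr : IsReducedWord H ⊥ r := hl.of_cons.left
    have haH : a⁻¹ ∈ H false ⊔ H true := by
      cases i
      · exact Subgroup.mem_sup_left (inv_mem ha)
      · exact Subgroup.mem_sup_right (inv_mem ha)
    obtain ⟨l', hl', hlen, hprod⟩ : ∃ l', IsReducedWord H ⊥ l' ∧ l'.length < n ∧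
        letterProd l' = a⁻¹ * letterProd ((i, a) :: (r ++ [(i, b)])) * a⁻¹⁻¹ := by
      by_cases hba : b * a = 1
      · exact ⟨r, hr, by simp at hn; omega, by simp [mul_assoc, hba]⟩
      · refine ⟨r ++ [(i, b * a)], hr.append (IsReducedWord.singleton (mul_mem hb ha)
          (by simpa using hba)) ?_, by simp at hn ⊢; omega, by simp [mul_assoc]⟩
        have := (List.isChain_append.1 hl.of_cons.1).2.2
        simpa using this
    obtain ⟨g, hg, h⟩ := ih _ hlen hl' rfl
    refine ⟨g * a⁻¹, mul_mem hg haH, ?_⟩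
    have heq : g * letterProd l' * g⁻¹ =
        g * a⁻¹ * letterProd ((i, a) :: (r ++ [(i, b)])) * (g * a⁻¹)⁻¹ := by
      rw [hprod]; group
    rwa [heq] at h
  · refine ⟨1, one_mem _, Or.inr ⟨_, hl, by simp, by simp, ?_⟩⟩
    rw [← List.cons_append, List.getLast?_concat]
    simpa using Ne.symm hij

/-- The subgroups `H false` and `H true` generate `G` as their amalgamated product over `T`. -/
structure IsAmalgam (H : Bool → Subgroup G) (T : Subgroup G) : Prop where
  base_le : ∀ i, T ≤ H i
  letterProd_notMem : ∀ l, IsReducedWord H T l → l ≠ [] → letterProd l ∉ T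
  sup_eq_top : H false ⊔ H true = ⊤

namespace IsAmalgam

variable (hA : IsAmalgam H T)
include hA

lemma eq_singleton_of_letterProd_mem {l : List (Bool × G)} (hl : IsReducedWord H T l)
    (hne : l ≠ []) {j : Bool} (hj : letterProd l ∈ H j) : l = [(j, letterProd l)] := by
  have key : ∀ {l : List (Bool × G)}, IsReducedWord H T l → l ≠ [] → letterProd l ∈ H j →
      ¬ ∀ q ∈ l.head?, j ≠ q.1 := by
    intro l hl hne hj hq
    refine hA.letterProd_notMem _ (hl.cons (inv_mem hj) ?_ hq) (by simp) (by simp)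
    simpa using hA.letterProd_notMem l hl hne
  rcases l with _ | ⟨⟨k, a⟩, r⟩
  · exact absurd rfl hne
  have hkj : j = k := by simpa using key hl hne hj
  subst hkj
  have hr : r = [] := by
    by_contra hr
    refine key hl.of_cons hr ?_ (List.isChain_cons.1 hl.1).1
    rw [letterProd_cons] at hj
    exact (mul_mem_cancel_left (hl.2 (j, a) (by simp)).1).1 hj
  subst hr
  simp

lemma length_le {l l' : List (Bool × G)} (hl : IsReducedWord H T l)
    (hl' : ∀ p ∈ l', p.2 ∈ H p.1) (h : letterProd l = letterProd l') :
    l.length ≤ l'.length := by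
  induction l' generalizing l with
  | nil =>
    by_contra hne
    exact hA.letterProd_notMem l hl (by rintro rfl; simp at hne) (by simp [h])
  | cons p l' ih =>
    rcases hl.exists_mul hA.base_le (inv_mem (hl' p (by simp))) with h' | ⟨l'', h1, h2, h3⟩
    · have := h'.2
      simp only [List.length_cons]
      omega
    · have := ih h1 (fun q hq => hl' q (List.mem_cons_of_mem _ hq)) (by rw [h2, h]; simp)
      simp only [List.length_cons]
      omega

lemma exists_eq_letterProd_mul (g : G) (i : Bool) :
    ∃ l, IsReducedWord H T l ∧ (∀ p ∈ l.getLast?, p.1 ≠ i) ∧ ∃ h ∈ H i, g = letterProd l * h := by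
  rcases exists_isReducedWord_of_mem_sup hA.base_le (hA.sup_eq_top ▸ Subgroup.mem_top g) with
    h | ⟨l, hl, rfl⟩
  · exact ⟨[], IsReducedWord.nil, by simp, g, hA.base_le i h, by simp⟩
  rcases l.eq_nil_or_concat' with rfl | ⟨r, ⟨j, b⟩, rfl⟩
  · exact ⟨[], IsReducedWord.nil, by simp, 1, one_mem _, by simp⟩
  by_cases hij : j = i
  · subst hij
    refine ⟨r, hl.left, ?_, b, (hl.2 (j, b) (by simp)).1, by simp⟩
    simpa using (List.isChain_append.1 hl.1).2.2
  · exact ⟨_, hl, by simpa using hij, 1, one_mem _, by simp⟩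

/-- Conjugating a letter outside the base by a reduced word not ending in its factor. -/
lemma eq_nil_of_conj_mem {l : List (Bool × G)} (hl : IsReducedWord H T l) {i j : Bool} {x : G}
    (hx : x ∈ H i) (hxT : x ∉ T) (hi : ∀ p ∈ l.getLast?, p.1 ≠ i)
    (hj : letterProd l * x * (letterProd l)⁻¹ ∈ H j) : l = [] ∧ j = i := by
  have hred : IsReducedWord H T (l ++ (i, x) :: invWord l) := by
    refine hl.append (hl.invWord.cons hx hxT ?_) (by simpa using hi)
    rw [head?_invWord]
    intro q hq
    obtain ⟨p, hp, rfl⟩ := Option.mem_map.1 hq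
    exact (hi p hp).symm
  have h := hA.eq_singleton_of_letterProd_mem hred (by simp) (j := j)
    (by simpa [mul_assoc] using hj)
  have hlen := congrArg List.length h
  simp only [List.length_append, List.length_cons, length_invWord, List.length_nil] at hlen
  have hnil : l = [] := List.length_eq_zero_iff.1 (by omega)
  subst hnil
  simp [invWord] at h
  exact ⟨rfl, h.symm⟩

/-- An element of a factor that is not conjugate into the base fixes a unique vertex. -/
lemma mem_of_conj_mem {i j : Bool} {x g : G} (hx : x ∈ H i) (hxT : ∀ h, h * x * h⁻¹ ∉ T)
    (hj : g * x * g⁻¹ ∈ H j) : j = i ∧ g ∈ H i := by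
  obtain ⟨l, hl, hlast, h, hh, rfl⟩ := hA.exists_eq_letterProd_mul g i
  obtain ⟨rfl, rfl⟩ := hA.eq_nil_of_conj_mem hl (x := h * x * h⁻¹)
    (mul_mem (mul_mem hh hx) (inv_mem hh)) (hxT h) hlast (by simpa [mul_assoc] using hj)
  simpa using hh

lemma mem_of_commute {i : Bool} {x g : G} (hx : x ∈ H i) (hxT : ∀ h, h * x * h⁻¹ ∉ T)
    (hg : Commute g x) : g ∈ H i :=
  (hA.mem_of_conj_mem (j := i) hx hxT (by rw [hg.eq]; simpa using hx)).2

/-- A cyclically reduced element is not conjugate to its square. -/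
lemma conj_ne_sq {l : List (Bool × G)} (hl : IsReducedWord H T l) (hne : l ≠ [])
    (hcyc : ∀ p ∈ l.getLast?, ∀ q ∈ l.head?, p.1 ≠ q.1) (g : G) :
    g * letterProd l * g⁻¹ ≠ letterProd l ^ 2 := by
  intro hsq
  have hpow : ∀ k : ℕ, g ^ k * letterProd l * (g ^ k)⁻¹ = letterProd l ^ 2 ^ k := by
    intro k
    induction k with
    | zero => simp
    | succ k ih =>
      rw [pow_succ', pow_succ' 2, pow_mul, ← hsq, conj_pow, ← ih]
      group
  have hrep : ∀ n : ℕ, IsReducedWord H T (List.replicate n l).flatten ∧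
      letterProd (List.replicate n l).flatten = letterProd l ^ n ∧
      ((List.replicate n l).flatten).length = n * l.length := by
    intro n
    refine ⟨⟨?_, ?_⟩, ?_, by simp⟩
    · rw [List.isChain_flatten (by simp [hne.symm])]
      refine ⟨fun m hm => (List.eq_of_mem_replicate hm) ▸ hl.1, ?_⟩
      exact List.isChain_replicate_of_rel _ (fun p hp q hq => hcyc p hp q hq)
    · intro p hp
      obtain ⟨m, hm, hpm⟩ := List.mem_flatten.1 hp
      exact hl.2 p ((List.eq_of_mem_replicate hm) ▸ hpm)
    · induction n with
      | zero => simp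
      | succ n ih => simp [List.replicate_succ, ih, pow_succ']
  obtain ⟨w, hw, hwg⟩ := exists_letterProd_eq_of_mem_sup
    (hA.sup_eq_top ▸ Subgroup.mem_top g : g ∈ H false ⊔ H true)
  obtain ⟨w', hw', hwg'⟩ := exists_letterProd_eq_of_mem_sup
    (hA.sup_eq_top ▸ Subgroup.mem_top g⁻¹ : g⁻¹ ∈ H false ⊔ H true)
  have hrepw : ∀ (w : List (Bool × G)) (k : ℕ), (∀ p ∈ w, p.2 ∈ H p.1) →
      (∀ p ∈ (List.replicate k w).flatten, p.2 ∈ H p.1) ∧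
      letterProd (List.replicate k w).flatten = letterProd w ^ k := by
    intro w k hw
    refine ⟨fun p hp => ?_, ?_⟩
    · obtain ⟨m, hm, hpm⟩ := List.mem_flatten.1 hp
      exact hw p ((List.eq_of_mem_replicate hm) ▸ hpm)
    · induction k with
      | zero => simp
      | succ n ih => simp [List.replicate_succ, ih, pow_succ']
  have hlen : ∀ k : ℕ, 2 ^ k * l.length ≤ k * w.length + l.length + k * w'.length := by
    intro k
    have h1 := hrepw w k hw
    have h2 := hrepw w' k hw'
    have := hA.length_le (hrep (2 ^ k)).1
      (l' := (List.replicate k w).flatten ++ l ++ (List.replicate k w').flatten) (by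
        intro p hp
        simp only [List.mem_append] at hp
        rcases hp with (hp | hp) | hp
        · exact h1.1 p hp
        · exact (hl.2 p hp).1
        · exact h2.1 p hp) (by
        rw [(hrep _).2.1, ← hpow, letterProd_append, letterProd_append, h1.2, h2.2, hwg, hwg',
          inv_pow])
    rw [(hrep _).2.2] at this
    simpa [add_assoc] using this
  have hpos : 1 ≤ l.length := List.length_pos_iff.2 hne
  set n := w.length + w'.length with hn
  have h := hlen (2 * (2 * n + 1))
  have hbound : (2 * n + 2) ^ 2 ≤ 2 ^ (2 * (2 * n + 1)) := by
    rw [mul_comm 2 (2 * n + 1), pow_mul]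
    exact Nat.pow_le_pow_left (Nat.lt_two_pow_self) 2
  set k := 2 * (2 * n + 1) with hk
  have hlt : k * n + 2 ≤ 2 ^ k := by nlinarith
  have hmul := Nat.mul_le_mul_right l.length hlt
  have hkn : k * n = k * w.length + k * w'.length := by rw [hn, mul_add]
  have := Nat.le_mul_of_pos_right (k * n) hpos
  rw [add_mul] at hmul
  omega

end IsAmalgam

end ReducedWords

section SubAmalgam

variable {G : Type*} [Group G] {H L : Bool → Subgroup G} {T : Subgroup G}

lemma IsReducedWord.of_le (hL : ∀ i, L i ≤ H i) (hLT : ∀ i, Disjoint (L i) T)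
    {l : List (Bool × G)} (hl : IsReducedWord L ⊥ l) : IsReducedWord H T l :=
  ⟨hl.1, fun p hp => ⟨hL _ (hl.2 p hp).1, fun hT => (hl.2 p hp).2
    (disjoint_iff_inf_le.1 (hLT p.1) ⟨(hl.2 p hp).1, hT⟩)⟩⟩

/-- The element `x` is nontrivial and conjugate to its square. -/
def IsConjSq (x : G) : Prop := x ≠ 1 ∧ ∃ g, g * x * g⁻¹ = x ^ 2

lemma IsConjSq.map {G' : Type*} [Group G'] {x : G} (hx : IsConjSq x) (f : G →* G')
    (hf : Function.Injective f) : IsConjSq (f x) := by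
  obtain ⟨h1, g, hg⟩ := hx
  refine ⟨by simpa using hf.ne h1, f g, ?_⟩
  rw [← map_inv, ← map_mul, ← map_mul, hg, map_pow]

lemma IsConjSq.conj {x : G} (hx : IsConjSq x) (g : G) : IsConjSq (g * x * g⁻¹) :=
  hx.map (MulAut.conj g).toMonoidHom (MulAut.conj g).injective

namespace IsAmalgam

variable (hA : IsAmalgam H T) (hL : ∀ i, L i ≤ H i) (hLT : ∀ i, Disjoint (L i) T)
include hA hL hLT

lemma mem_of_mem_sup {x : G} (hx : x ∈ L false ⊔ L true) {j : Bool} (hj : x ∈ H j) : x ∈ L j := by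
  rcases exists_isReducedWord_of_mem_sup (T := ⊥) (by simp) hx with h | ⟨l, hl, rfl⟩
  · rw [Subgroup.mem_bot.1 h]; exact one_mem _
  · by_cases hne : l = []
    · subst hne; exact one_mem _
    · have h := hA.eq_singleton_of_letterProd_mem (hl.of_le hL hLT) hne hj
      exact (hl.2 (j, letterProd l) (by rw [h]; simp)).1

lemma exists_conj_mem_of_isConjSq {x : G} (hx : x ∈ L false ⊔ L true) (hsq : IsConjSq x) :
    ∃ g ∈ L false ⊔ L true, ∃ i, g * x * g⁻¹ ∈ H i := by
  rcases exists_isReducedWord_of_mem_sup (T := ⊥) (by simp) hx with h | ⟨l, hl, rfl⟩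
  · exact absurd (Subgroup.mem_bot.1 h) hsq.1
  obtain ⟨g, hg, ⟨i, hi⟩ | ⟨l', hl', hne, hprod, hcyc⟩⟩ := hl.exists_conj
  · exact ⟨g, hg, i, hL i hi⟩
  · obtain ⟨-, k, hk⟩ := hprod ▸ hsq.conj g
    exact absurd hk (hA.conj_ne_sq (hl'.of_le hL hLT) hne hcyc k)

/-- If `L i` is malnormal relative to the base, then an element of the subgroup generated by the
`L i` which moves an edge to an edge touching the same vertices is in `L false * L true`. -/
lemma exists_eq_mul_of_conj_mem
    (hmal : ∀ i, ∀ u ∈ L i, u ≠ 1 → ∀ s ∈ T, s ≠ 1 → u⁻¹ * s * u ∉ T)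
    {m s : G} (hm : m ∈ L false ⊔ L true) (hs : s ∈ H false) (hs1 : s ≠ 1)
    (hms : m⁻¹ * s * m ∈ H true) : ∃ a ∈ L false, ∃ b ∈ L true, m = a * b := by
  obtain ⟨a, ha, b, hb, w, hw, hhead, hlast, rfl⟩ : ∃ a ∈ L false, ∃ b ∈ L true,
      ∃ w, IsReducedWord L ⊥ w ∧ (∀ p ∈ w.head?, p.1 ≠ false) ∧
        (∀ p ∈ w.getLast?, p.1 ≠ true) ∧ m = a * letterProd w * b := by
    obtain ⟨l, hl, hlm⟩ : ∃ l, IsReducedWord L ⊥ l ∧ letterProd l = m := by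
      rcases exists_isReducedWord_of_mem_sup (T := ⊥) (by simp) hm with h | h
      · exact ⟨[], IsReducedWord.nil, (Subgroup.mem_bot.1 h).symm⟩
      · exact h
    obtain ⟨a, ha, r, hr, hhead, hrm⟩ : ∃ a ∈ L false, ∃ r, IsReducedWord L ⊥ r ∧
        (∀ p ∈ r.head?, p.1 ≠ false) ∧ a * letterProd r = m := by
      rcases l with _ | ⟨⟨_ | _, a⟩, r⟩
      · exact ⟨1, one_mem _, [], IsReducedWord.nil, by simp, by simpa using hlm⟩
      · exact ⟨a, (hl.2 (false, a) (by simp)).1, r, hl.of_cons,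
          fun p hp => ((List.isChain_cons.1 hl.1).1 p hp).symm, by simpa using hlm⟩
      · exact ⟨1, one_mem _, _, hl, by simp, by simpa using hlm⟩
    rcases r.eq_nil_or_concat' with rfl | ⟨w, ⟨_ | _, b⟩, rfl⟩
    · exact ⟨a, ha, 1, one_mem _, [], IsReducedWord.nil, by simp, by simp, by simp [← hrm]⟩
    · exact ⟨a, ha, 1, one_mem _, _, hr, hhead, by simp, by simp [← hrm]⟩
    · refine ⟨a, ha, b, (hr.2 (true, b) (by simp)).1, w, hr.left, ?_, ?_, ?_⟩
      · intro p hp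
        exact hhead p (by rw [List.head?_append]; simp [Option.mem_def.1 hp])
      · simpa using (List.isChain_append.1 hr.1).2.2
      · simp [← hrm, mul_assoc]
  refine ⟨a, ha, b, hb, ?_⟩
  have hmem : (letterProd w)⁻¹ * (a⁻¹ * s * a) * letterProd w ∈ H true := by
    have := mul_mem (mul_mem (hL _ hb) hms) (inv_mem (hL _ hb))
    convert this using 1
    group
  have hsH : a⁻¹ * s * a ∈ H false := mul_mem (mul_mem (inv_mem (hL _ ha)) hs) (hL _ ha)
  have hs1' : a⁻¹ * s * a ≠ 1 := by simpa [mul_eq_one_iff_eq_inv, inv_mul_eq_iff_eq_mul] using hs1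
  have hw' := hw.of_le hL hLT
  rcases w with _ | ⟨⟨i, c⟩, r⟩
  · simp
  obtain rfl : i = true := by simpa using hhead
  have hc := (hw.2 (true, c) (by simp)).1
  have hc1 : c ≠ 1 := by simpa using (hw.2 (true, c) (by simp)).2
  exfalso
  by_cases hsT : a⁻¹ * s * a ∈ T
  · have hcT := hmal _ c hc hc1 _ hsT hs1'
    have := (hA.eq_nil_of_conj_mem (i := true) (j := true) (x := c⁻¹ * (a⁻¹ * s * a) * c)
      hw'.of_cons.invWord
      (mul_mem (mul_mem (inv_mem (hL _ hc)) (hA.base_le _ hsT)) (hL _ hc)) hcT (by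
        rw [getLast?_invWord]
        intro q hq
        obtain ⟨p, hp, rfl⟩ := Option.mem_map.1 hq
        exact ((List.isChain_cons.1 hw.1).1 p hp).symm) (by
        simpa [mul_assoc] using hmem)).1
    have hr : r = [] := List.length_eq_zero_iff.1 (by rw [← length_invWord, this]; rfl)
    subst hr
    simp at hlast
  · have := (hA.eq_nil_of_conj_mem (i := false) (j := true) (x := a⁻¹ * s * a)
      hw'.invWord hsH hsT (by simp [getLast?_invWord]) (by simpa [mul_assoc] using hmem)).1
    simpa [length_invWord] using congrArg List.length this

variable (hbase : ∀ x : G, IsConjSq x → ∀ h, h * x * h⁻¹ ∉ T)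
  {z : Bool → G} (hz : ∀ i, z i ∈ L i) (hzsq : ∀ i, IsConjSq (z i))
  (hgen : ∀ i, ∀ P : Subgroup G, z i ∈ P →
    (∀ x ∈ P, IsConjSq x → ∀ y, Commute y x → y ∈ P) → H i ≤ P)
include hbase hz hzsq hgen

lemma exists_conj_map_le (d : G ≃* G) (hd : ∀ x ∈ L false ⊔ L true, d x ∈ L false ⊔ L true)
    (i : Bool) :
    ∃ g ∈ L false ⊔ L true, ∃ j, ∀ x ∈ H i, g * d x * g⁻¹ ∈ H j := by
  have hzi : z i ∈ L false ⊔ L true := by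
    have := hz i
    cases i
    · exact Subgroup.mem_sup_left this
    · exact Subgroup.mem_sup_right this
  obtain ⟨g, hg, j, hj⟩ := hA.exists_conj_mem_of_isConjSq hL hLT (hd _ hzi)
    ((hzsq i).map d.toMonoidHom d.injective)
  refine ⟨g, hg, j, hgen i ((H j).comap ((MulAut.conj g).toMonoidHom.comp d.toMonoidHom))
    (by simpa using hj) ?_⟩
  intro x hx hxsq y hy
  set f := (MulAut.conj g).toMonoidHom.comp d.toMonoidHom with hf
  have hinj : Function.Injective f := (MulAut.conj g).injective.comp d.injective
  exact hA.mem_of_commute hx (hbase _ (hxsq.map f hinj)) (hy.map f)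

/-- An automorphism preserving the subgroup generated by the `L i` permutes the factors up to
conjugation by elements of that subgroup. -/
lemma exists_conj_map_eq (d : G ≃* G)
    (hd : ∀ x, d x ∈ L false ⊔ L true ↔ x ∈ L false ⊔ L true) :
    ∃ σ : Bool → Bool, Function.Injective σ ∧ ∀ i, ∃ g ∈ L false ⊔ L true,
      ∀ x, g * d x * g⁻¹ ∈ H (σ i) ↔ x ∈ H i := by
  choose g hg σ hσ using
    hA.exists_conj_map_le hL hLT hbase hz hzsq hgen d fun x hx => (hd x).2 hx
  choose k hk τ hτ using
    hA.exists_conj_map_le hL hLT hbase hz hzsq hgen d.symm fun x hx => (hd _).1 (by simpa using hx)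
  have hcomp : ∀ i, τ (σ i) = i ∧ k (σ i) * d.symm (g i) ∈ H i := by
    intro i
    refine hA.mem_of_conj_mem (hL _ (hz i)) (hbase _ (hzsq i)) ?_
    have := hτ _ _ (hσ i _ (hL _ (hz i)))
    simpa [mul_assoc] using this
  refine ⟨σ, Function.LeftInverse.injective (g := τ) fun i => (hcomp i).1, fun i =>
    ⟨g i, hg i, fun x => ⟨fun hx => ?_, hσ i x⟩⟩⟩
  have h1 := hτ _ _ hx
  rw [(hcomp i).1] at h1
  have h2 := (hcomp i).2
  have h3 := mul_mem (mul_mem (inv_mem h2) h1) h2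
  simpa [mul_assoc] using h3

/-- If moreover the factors are not swapped, then after one conjugation both are preserved. -/
lemma exists_conj_map_eq_of_forall_ne
    (hmal : ∀ i, ∀ u ∈ L i, u ≠ 1 → ∀ s ∈ T, s ≠ 1 → u⁻¹ * s * u ∉ T) (hT : T ≠ ⊥) (d : G ≃* G)
    (hd : ∀ x, d x ∈ L false ⊔ L true ↔ x ∈ L false ⊔ L true)
    (hswap : ∀ g ∈ L false ⊔ L true, ¬ ∀ x, g * d x * g⁻¹ ∈ H true ↔ x ∈ H false) :
    ∃ g ∈ L false ⊔ L true, ∀ i x, g * d x * g⁻¹ ∈ H i ↔ x ∈ H i := by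
  obtain ⟨σ, hσ, h⟩ := hA.exists_conj_map_eq hL hLT hbase hz hzsq hgen d hd
  obtain ⟨g, hg, h0⟩ := h false
  obtain ⟨k, hk, h1⟩ := h true
  have hσ0 : σ false = false := by
    by_contra hne
    rw [Bool.not_eq_false] at hne
    exact hswap g hg (hne ▸ h0)
  have hσ1 : σ true = true := by
    by_contra hne
    rw [Bool.not_eq_true] at hne
    exact absurd (hσ (hσ0.trans hne.symm)) (by simp)
  rw [hσ0] at h0
  rw [hσ1] at h1
  obtain ⟨t, ht, ht1⟩ := (Subgroup.bot_or_exists_ne_one T).resolve_left hT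
  have hdt : g * d t * g⁻¹ ≠ 1 := by
    simpa [mul_eq_one_iff_eq_inv] using ht1
  obtain ⟨a, ha, b, hb, hab⟩ := hA.exists_eq_mul_of_conj_mem hL hLT hmal (m := g * k⁻¹)
    (mul_mem hg (inv_mem hk)) ((h0 _).2 (hA.base_le _ ht)) hdt
    (by simpa [mul_assoc] using (h1 _).2 (hA.base_le _ ht))
  have hgk : a⁻¹ * g = b * k := by
    rw [mul_inv_eq_iff_eq_mul] at hab
    rw [hab]
    group
  refine ⟨a⁻¹ * g, mul_mem (inv_mem (Subgroup.mem_sup_left ha)) hg, ?_⟩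
  have hconj : ∀ (i : Bool) (c y : G), c ∈ H i → (c * y * c⁻¹ ∈ H i ↔ y ∈ H i) := by
    intro i c y hc
    rw [mul_mem_cancel_right (inv_mem hc), mul_mem_cancel_left hc]
  rintro (_ | _) x
  · rw [← h0 x, ← hconj false a⁻¹ (g * d x * g⁻¹) (inv_mem (hL _ ha))]
    simp [mul_assoc]
  · rw [← h1 x, hgk, ← hconj true b (k * d x * k⁻¹) (hL _ hb)]
    simp [mul_assoc]

end IsAmalgam

end SubAmalgam

section Elementary

variable {F : Type*} [Field F]

/-- The elementary matrix `1 + x eᵢⱼ` of `SL(3,F)`. -/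
abbrev elemSL (i j : Fin 3) (x : F) (hij : i ≠ j := by first | assumption | decide) :
    SpecialLinearGroup (Fin 3) F :=
  SpecialLinearGroup.transvection hij x

lemma elemSL_coe (i j : Fin 3) (x : F) (hij : i ≠ j) :
    (elemSL i j x hij : Matrix (Fin 3) (Fin 3) F) = 1 + single i j x := rfl

lemma elemSL_inj {i j : Fin 3} {hij : i ≠ j} {x y : F} :
    elemSL i j x hij = elemSL i j y hij ↔ x = y := by
  refine ⟨fun h => ?_, fun h => h ▸ rfl⟩
  have := congrArg (fun M : SpecialLinearGroup (Fin 3) F => M i j) h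
  simpa [elemSL_coe, hij] using this

lemma elemSL_zero (i j : Fin 3) (hij : i ≠ j) : elemSL i j (0 : F) hij = 1 :=
  SpecialLinearGroup.transvection_coeff_zero hij

lemma elemSL_add (i j : Fin 3) (x y : F) (hij : i ≠ j) :
    elemSL i j (x + y) hij = elemSL i j x hij * elemSL i j y hij :=
  SpecialLinearGroup.transvection_add hij x y

lemma elemSL_ne_one {i j : Fin 3} {hij : i ≠ j} {x : F} (hx : x ≠ 0) :
    elemSL i j x hij ≠ 1 := by
  rw [← elemSL_zero i j hij]
  exact fun h => hx (elemSL_inj.1 h)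

lemma commute_elemSL_iff {i j : Fin 3} {hij : i ≠ j} {x : F} (hx : x ≠ 0)
    (X : SpecialLinearGroup (Fin 3) F) :
    Commute X (elemSL i j x hij) ↔
      (∀ a, a ≠ i → X a i = 0) ∧ (∀ b, b ≠ j → X j b = 0) ∧ X i i = X j j := by
  have key : Commute X (elemSL i j x hij) ↔
      (X : Matrix (Fin 3) (Fin 3) F) * single i j x = single i j x * X := by
    rw [commute_iff_eq, ← SpecialLinearGroup.coeMonoidHom_injective.eq_iff]
    simp [SpecialLinearGroup.coeMonoidHom_apply, elemSL_coe, mul_add, add_mul]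
  rw [key]
  constructor
  · intro h
    refine ⟨fun a ha => ?_, fun b hb => ?_, ?_⟩
    · have := congrFun (congrFun h a) j
      simpa [hx, ha] using this
    · have := congrFun (congrFun h i) b
      simpa [hx, hb] using this
    · have := congrFun (congrFun h i) j
      simp only [mul_single_apply_same, single_mul_apply_same] at this
      exact mul_right_cancel₀ hx (this.trans (mul_comm _ _))
  · rintro ⟨h1, h2, h3⟩
    ext a b
    by_cases ha : a = i <;> by_cases hb : b = j
    · subst ha hb
      simp [h3, mul_comm]
    · subst ha
      simp [hb, h2 b hb]
    · subst hb
      simp [ha, h1 a ha]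
    · simp [ha, hb]

lemma elemSL_mul_apply (i j : Fin 3) (x : F) (hij : i ≠ j) (M : SpecialLinearGroup (Fin 3) F)
    (a b : Fin 3) : (elemSL i j x hij * M) a b = M a b + if a = i then x * M j b else 0 := by
  have : (elemSL i j x hij * M : SpecialLinearGroup (Fin 3) F) a b =
      ((1 + single i j x) * (M : Matrix (Fin 3) (Fin 3) F)) a b := rfl
  rw [this, Matrix.add_mul, Matrix.one_mul, Matrix.add_apply]
  split_ifs with h
  · subst h
    simp
  · simp [h]

lemma mul_elemSL_apply (i j : Fin 3) (x : F) (hij : i ≠ j) (M : SpecialLinearGroup (Fin 3) F)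
    (a b : Fin 3) : (M * elemSL i j x hij) a b = M a b + if b = j then M a i * x else 0 := by
  have : (M * elemSL i j x hij : SpecialLinearGroup (Fin 3) F) a b =
      ((M : Matrix (Fin 3) (Fin 3) F) * (1 + single i j x)) a b := rfl
  rw [this, Matrix.mul_add, Matrix.mul_one, Matrix.add_apply]
  split_ifs with h
  · subst h
    simp
  · simp [h]

lemma elemSL_apply (i j : Fin 3) (x : F) (hij : i ≠ j) (a b : Fin 3) :
    elemSL i j x hij a b = (if a = b then 1 else 0) + if a = i ∧ b = j then x else 0 := by
  simp only [elemSL_coe, Matrix.add_apply, one_apply, single_apply]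
  grind

lemma diag2n_apply {i j : Fin 3} (hij : i ≠ j) {c : F} (hc : c ≠ 0) (a b : Fin 3) :
    SpecialLinearGroup.diag2n hij c hc a b =
      if a = b then (if a = i then c else if a = j then c⁻¹ else 1) else 0 := by
  rw [SpecialLinearGroup.diag2n_coe, diagonal_apply]

lemma diag2n_mul_apply {i j : Fin 3} (hij : i ≠ j) {c : F} (hc : c ≠ 0)
    (M : SpecialLinearGroup (Fin 3) F) (a b : Fin 3) :
    (SpecialLinearGroup.diag2n hij c hc * M) a b =
      (if a = i then c else if a = j then c⁻¹ else 1) * M a b := by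
  have : (SpecialLinearGroup.diag2n hij c hc * M : SpecialLinearGroup (Fin 3) F) a b =
      ((SpecialLinearGroup.diag2n hij c hc).1 * (M : Matrix (Fin 3) (Fin 3) F)) a b := rfl
  rw [this, SpecialLinearGroup.diag2n_coe, diagonal_mul]

lemma eq_top_of_elemSL_mem (P : Subgroup (SpecialLinearGroup (Fin 3) F))
    (hP : ∀ (i j : Fin 3) (hij : i ≠ j) (x : F), elemSL i j x hij ∈ P) : P = ⊤ := by
  rw [eq_top_iff]
  intro M _
  refine SpecialLinearGroup.diagonal_transvection_induction' (· ∈ P) M ?_ hP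
    (fun _ _ => P.mul_mem)
  intro i j hij c hc
  have : SpecialLinearGroup.diag2n hij c hc =
      elemSL i j c hij * (elemSL j i (-c⁻¹) hij.symm * (elemSL i j c hij *
        (elemSL i j (-1) hij * (elemSL j i 1 hij.symm * elemSL i j (-1) hij)))) := by
    ext a b
    simp only [elemSL_mul_apply, elemSL_apply, diag2n_apply]
    grind
  rw [this]
  exact P.mul_mem (hP ..) (P.mul_mem (hP ..) (P.mul_mem (hP ..) (P.mul_mem (hP ..)
    (P.mul_mem (hP ..) (hP ..)))))

lemma isConjSq_elemSL [CharZero F] {i j : Fin 3} {hij : i ≠ j} {x : F} (hx : x ≠ 0) :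
    IsConjSq (elemSL i j x hij) := by
  refine ⟨elemSL_ne_one hx, ?_⟩
  obtain ⟨k, hik, hjk⟩ : ∃ k : Fin 3, k ≠ i ∧ k ≠ j := by
    revert i j; decide
  refine ⟨SpecialLinearGroup.diag2n (i := i) (j := k) hik.symm 2 two_ne_zero, ?_⟩
  rw [mul_inv_eq_iff_eq_mul]
  ext a b
  rw [pow_two, mul_assoc, elemSL_mul_apply, elemSL_mul_apply, diag2n_mul_apply, elemSL_apply,
    elemSL_mul_apply]
  simp only [diag2n_apply]
  grind

lemma elemSL_mul_elemSL_comm (i j k : Fin 3) (x y : F) (hij : i ≠ j) (hjk : j ≠ k) (hik : i ≠ k) :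
    elemSL i j x hij * elemSL j k y hjk =
      elemSL i k (x * y) hik * (elemSL j k y hjk * elemSL i j x hij) := by
  ext a b
  simp only [elemSL_mul_apply, elemSL_apply]
  grind

/-- A subgroup containing `E₁₃(1)` and the centralizers of its elements conjugate to their square
contains all elementary matrices. -/
lemma eq_top_of_elemSL_mem_of_commute [CharZero F] (P : Subgroup (SpecialLinearGroup (Fin 3) F))
    (h : elemSL 0 2 1 ∈ P) (hc : ∀ x ∈ P, IsConjSq x → ∀ y, Commute y x → y ∈ P) : P = ⊤ := by
  have step : ∀ (i j : Fin 3) (hij : i ≠ j), elemSL i j 1 hij ∈ P →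
      ∀ (k l : Fin 3) (hkl : k ≠ l), l ≠ i → k ≠ j → ∀ x : F, elemSL k l x hkl ∈ P := by
    intro i j hij hP k l hkl hli hkj x
    refine hc _ hP (isConjSq_elemSL one_ne_zero) _ ?_
    rw [commute_elemSL_iff one_ne_zero]
    simp only [elemSL_apply]
    grind
  have h01 := step 0 2 (by decide) h 0 1 (by decide) (by decide) (by decide)
  have h02 := step 0 2 (by decide) h 0 2 (by decide) (by decide) (by decide)
  have h12 := step 0 2 (by decide) h 1 2 (by decide) (by decide) (by decide)
  have h10 := step 1 2 (by decide) (h12 1) 1 0 (by decide) (by decide) (by decide)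
  have h20 := step 1 0 (by decide) (h10 1) 2 0 (by decide) (by decide) (by decide)
  have h21 := step 2 0 (by decide) (h20 1) 2 1 (by decide) (by decide) (by decide)
  refine eq_top_of_elemSL_mem P fun i j hij => ?_
  fin_cases i <;> fin_cases j <;> first | exact absurd rfl hij | assumption

end Elementary

section Rigidity

variable {F F' : Type*} [Field F] [Field F']

lemma SpecialLinearGroup.entry_eq {M N : SpecialLinearGroup (Fin 3) F} (h : M = N)
    (a b : Fin 3) : M a b = N a b := by rw [h]

lemma SpecialLinearGroup.val_mul (M N : SpecialLinearGroup (Fin 3) F) :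
    (M * N).val = M.val * N.val := rfl

lemma SpecialLinearGroup.mul_apply_three (M N : SpecialLinearGroup (Fin 3) F) (a b : Fin 3) :
    (M * N) a b = M a 0 * N 0 b + M a 1 * N 1 b + M a 2 * N 2 b := by
  have : (M * N) a b = ((M : Matrix (Fin 3) (Fin 3) F) * (N : Matrix (Fin 3) (Fin 3) F)) a b := rfl
  rw [this, Matrix.mul_apply, Fin.sum_univ_three]

lemma exists_pow_three_eq_elemSL (i j k : Fin 3) (hij : i ≠ j) (hik : i ≠ k) (hkj : k ≠ j)
    (X : SpecialLinearGroup (Fin 3) F) (h1 : Commute X (elemSL i j 1))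
    (h2 : Commute X (elemSL i k 1)) (h3 : Commute X (elemSL k j 1)) :
    ∃ y : F, X ^ 3 = elemSL i j y := by
  rw [commute_elemSL_iff one_ne_zero] at h1 h2 h3
  obtain ⟨a1, b1, c1⟩ := h1
  obtain ⟨a2, b2, c2⟩ := h2
  obtain ⟨a3, b3, c3⟩ := h3
  have hX : (X : Matrix (Fin 3) (Fin 3) F) = X i i • 1 + single i j (X i j) := by
    ext a b
    simp only [Matrix.add_apply, Matrix.smul_apply, one_apply, single_apply, smul_eq_mul]
    have : ∀ l : Fin 3, l = i ∨ l = j ∨ l = k := by omega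
    rcases this a with rfl | rfl | rfl <;> rcases this b with rfl | rfl | rfl <;> grind
  have hdet : X i i ^ 3 = 1 := by
    have hd := X.det_coe
    rw [det_fin_three] at hd
    obtain ⟨M, hM⟩ : ∃ M : Matrix (Fin 3) (Fin 3) F, M = X := ⟨_, rfl⟩
    rw [← hM] at hd hX ⊢
    have : ∀ a b : Fin 3, M a b = if a = b then M i i else if a = i ∧ b = j then M i j else 0 := by
      intro a b
      have := congrFun (congrFun hX a) b
      simp only [Matrix.add_apply, Matrix.smul_apply, one_apply, single_apply, smul_eq_mul] at this
      rw [this]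
      grind
    generalize M i i = z at *
    generalize M i j = x at *
    rw [this 0 0, this 0 1, this 0 2, this 1 0, this 1 1, this 1 2, this 2 0, this 2 1,
      this 2 2] at hd
    grind
  refine ⟨3 * X i i ^ 2 * X i j, ?_⟩
  apply Subtype.ext
  show (X : Matrix (Fin 3) (Fin 3) F) ^ 3 = 1 + single i j _
  have hs : single i j (X i j) * single i j (X i j) = (0 : Matrix (Fin 3) (Fin 3) F) :=
    single_mul_single_of_ne _ _ _ _ hij.symm _
  generalize X i j = x at *
  generalize X i i = z at *
  rw [hX, pow_succ, pow_two]
  simp only [mul_add, add_mul, Matrix.mul_one, Matrix.one_mul, smul_mul_assoc, mul_smul_comm, hs,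
    smul_zero, add_zero]
  ext a b
  simp only [Matrix.add_apply, Matrix.smul_apply, one_apply, single_apply, smul_eq_mul]
  grind

lemma exists_map_elemSL [CharZero F]
    (φ : SpecialLinearGroup (Fin 3) F ≃* SpecialLinearGroup (Fin 3) F')
    {i j : Fin 3} {hij : i ≠ j} (h : φ (elemSL i j 1 hij) = elemSL i j 1) (x : F) :
    ∃ y : F', φ (elemSL i j x hij) = elemSL i j y := by
  obtain ⟨k, hik, hkj⟩ : ∃ k : Fin 3, i ≠ k ∧ k ≠ j := by
    clear h; revert i j; decide
  have hx : elemSL i j x hij = elemSL i j (x / 3) hij ^ 3 := by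
    rw [pow_succ, pow_two, ← elemSL_add,
      ← elemSL_add]
    congr 1
    field_simp
    norm_num
  have key : ∀ Y : SpecialLinearGroup (Fin 3) F', Commute Y (elemSL i j 1) →
      Commute (φ (elemSL i j (x / 3) hij)) Y := by
    intro Y hY
    have h1 : Commute (φ.symm Y) (elemSL i j 1 hij) := by
      have := hY.map φ.symm
      rwa [← h, φ.symm_apply_apply] at this
    have h2 : Commute (φ.symm Y) (elemSL i j (x / 3) hij) := by
      by_cases hx0 : x / 3 = 0
      · rw [hx0, elemSL_zero]
        exact Commute.one_right _
      · rwa [commute_elemSL_iff hx0, ← commute_elemSL_iff one_ne_zero]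
    have := h2.map φ
    rw [φ.apply_symm_apply] at this
    exact this.symm
  rw [hx, map_pow]
  refine exists_pow_three_eq_elemSL i j k hij hik hkj _ (key _ (Commute.refl _)) (key _ ?_)
    (key _ ?_)
  all_goals
    rw [commute_elemSL_iff one_ne_zero]
    simp only [elemSL_apply]
    grind

lemma exists_ringEquiv_of_map_elemSL [CharZero F] [CharZero F']
    (φ : SpecialLinearGroup (Fin 3) F ≃* SpecialLinearGroup (Fin 3) F')
    (h01 : φ (elemSL 0 1 1) = elemSL 0 1 1) (h12 : φ (elemSL 1 2 1) = elemSL 1 2 1) :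
    ∃ α : F ≃+* F', ∀ x, φ (elemSL 0 1 x) = elemSL 0 1 (α x) ∧
      φ (elemSL 1 2 x) = elemSL 1 2 (α x) ∧ φ (elemSL 0 2 x) = elemSL 0 2 (α x) := by
  have h02 : φ (elemSL 0 2 1) = elemSL 0 2 1 := by
    have e := congrArg φ (elemSL_mul_elemSL_comm 0 1 2 (1 : F) 1 (by decide) (by decide)
      (by decide))
    have e' := elemSL_mul_elemSL_comm 0 1 2 (1 : F') 1 (by decide) (by decide) (by decide)
    simp only [map_mul, h01, h12, mul_one] at e e'
    exact mul_right_cancel (e.symm.trans e')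
  choose f01 hf01 using exists_map_elemSL φ h01
  choose f12 hf12 using exists_map_elemSL φ h12
  choose f02 hf02 using exists_map_elemSL φ h02
  have one01 : f01 1 = 1 := by rw [← elemSL_inj (i := 0) (j := 1) (hij := by decide), ← hf01, h01]
  have one12 : f12 1 = 1 := by rw [← elemSL_inj (i := 1) (j := 2) (hij := by decide), ← hf12, h12]
  have hmul : ∀ x y, f02 (x * y) = f01 x * f12 y := by
    intro x y
    have e := congrArg φ (elemSL_mul_elemSL_comm 0 1 2 x y (by decide) (by decide) (by decide))
    have e' := elemSL_mul_elemSL_comm 0 1 2 (f01 x) (f12 y) (by decide) (by decide) (by decide)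
    simp only [map_mul, hf01, hf12, hf02] at e
    exact elemSL_inj.1 (mul_right_cancel (e.symm.trans e'))
  have e1 : ∀ x, f02 x = f01 x := fun x => by simpa [one12] using hmul x 1
  have e2 : ∀ x, f02 x = f12 x := fun x => by simpa [one01] using hmul 1 x
  let α : F →+* F' :=
    { toFun := f02
      map_one' := by rw [e1, one01]
      map_mul' := fun x y => by rw [hmul, e1, e2]
      map_zero' := by
        rw [← elemSL_inj (i := 0) (j := 2) (hij := by decide), ← hf02,
          elemSL_zero, map_one,
          elemSL_zero]
      map_add' := fun x y => by
        rw [← elemSL_inj (i := 0) (j := 2) (hij := by decide), ← hf02,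
          elemSL_add, map_mul, hf02, hf02,
          elemSL_add] }
  have hsurj : Function.Surjective α := by
    intro y
    obtain ⟨x, hx⟩ := exists_map_elemSL φ.symm (i := 0) (j := 2) (hij := by decide)
      (by rw [← h02, φ.symm_apply_apply]) y
    refine ⟨x, ?_⟩
    show f02 x = y
    rw [← elemSL_inj (i := 0) (j := 2) (hij := by decide), ← hf02, ← hx, φ.apply_symm_apply]
  refine ⟨RingEquiv.ofBijective α ⟨α.injective, hsurj⟩, fun x => ⟨?_, ?_, ?_⟩⟩
  · rw [hf01, ← e1]; rfl
  · rw [hf12, ← e2]; rfl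
  · rw [hf02]; rfl

/-- The Weyl element of the `(i, j)` root subgroup. -/
def weylSL (F : Type*) [Field F] (i j : Fin 3) (hij : i ≠ j := by decide) :
    SpecialLinearGroup (Fin 3) F :=
  elemSL i j 1 hij * (elemSL j i (-1) hij.symm * elemSL i j 1 hij)

lemma elemSL_eq_conj_weylSL (i j : Fin 3) (hij : i ≠ j) (x : F) :
    elemSL j i x hij.symm * weylSL F i j hij = weylSL F i j hij * elemSL i j (-x) hij := by
  ext a b
  simp only [weylSL, elemSL_mul_apply, mul_elemSL_apply, elemSL_apply]
  grind

lemma eq_id_of_map_elemSL [CharZero F]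
    (ψ : SpecialLinearGroup (Fin 3) F →* SpecialLinearGroup (Fin 3) F)
    (h01 : ∀ x, ψ (elemSL 0 1 x) = elemSL 0 1 x) (h12 : ∀ x, ψ (elemSL 1 2 x) = elemSL 1 2 x)
    (h02 : ∀ x, ψ (elemSL 0 2 x) = elemSL 0 2 x) (h10 : ψ (elemSL 1 0 (-1)) = elemSL 1 0 (-1)) :
    ψ = MonoidHom.id _ := by
  have hw01 : ψ (weylSL F 0 1) = weylSL F 0 1 := by
    simp only [weylSL, map_mul, h01, h10]
  have h21 : ψ (elemSL 2 1 (-1)) = elemSL 2 1 (-1) := by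
    obtain ⟨Z, hZ⟩ : ∃ Z, Z = ψ (elemSL 2 1 (-1)) := ⟨_, rfl⟩
    rw [← hZ]
    have c1 : Commute Z (elemSL 0 1 1) := by
      rw [hZ, ← h01]
      refine Commute.map ?_ ψ
      rw [commute_elemSL_iff one_ne_zero]
      simp only [elemSL_apply]
      grind
    have c2 : elemSL 0 1 1 * (elemSL 1 2 1 * (Z * elemSL 1 2 1)) =
        (elemSL 1 2 1 * (Z * elemSL 1 2 1)) * elemSL 0 2 1 := by
      rw [hZ, ← h01, ← h12, ← h02, ← map_mul, ← map_mul, ← map_mul, ← map_mul]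
      congr 1
      ext a b
      simp only [elemSL_mul_apply, mul_elemSL_apply, elemSL_apply]
      grind
    have c3 : Z * (elemSL 1 2 1 * (Z * elemSL 1 2 1)) =
        (elemSL 1 2 1 * (Z * elemSL 1 2 1)) * elemSL 1 2 1 := by
      rw [hZ, ← h12, ← map_mul, ← map_mul, ← map_mul, ← map_mul]
      congr 1
      ext a b
      simp only [elemSL_mul_apply, mul_elemSL_apply, elemSL_apply]
      grind
    obtain ⟨t, ht⟩ : ∃ t, Z = elemSL 2 1 (-1) * elemSL 0 1 t := by
      refine ⟨Z 0 1, ?_⟩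
      rw [commute_elemSL_iff one_ne_zero] at c1
      have c21 := SpecialLinearGroup.entry_eq c2 0 1
      have c22 := SpecialLinearGroup.entry_eq c2 0 2
      have c31 := SpecialLinearGroup.entry_eq c3 1 2
      have c32 := SpecialLinearGroup.entry_eq c3 0 1
      rw [SpecialLinearGroup.mul_apply_three] at c31 c32
      simp only [elemSL_mul_apply, mul_elemSL_apply] at c21 c22 c31 c32
      obtain ⟨p1, p2, p3⟩ := c1
      have z10 := p1 1 (by decide)
      have z20 := p1 2 (by decide)
      have z12 := p2 2 (by decide)
      have hd := Z.det_coe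
      rw [det_fin_three, z10, z20, z12] at hd
      simp [z10, z12] at c21 c22 c31 c32
      have m1 : Z 0 0 = 1 := by grind
      have hall : ∀ a : Fin 3, a = 0 ∨ a = 1 ∨ a = 2 := by decide
      ext a b
      simp only [elemSL_mul_apply, elemSL_apply]
      rcases hall a with rfl | rfl | rfl <;> rcases hall b with rfl | rfl | rfl <;> simp <;> grind
    have c4 : Z * (elemSL 1 0 1 * Z * elemSL 1 0 (-1)) =
        (elemSL 1 0 1 * Z * elemSL 1 0 (-1)) * Z := by
      have h10' : ψ (elemSL 1 0 1) = elemSL 1 0 1 := by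
        rw [show elemSL 1 0 (1 : F) = (elemSL 1 0 (-1))⁻¹ by
          rw [SpecialLinearGroup.transvection_inv, neg_neg], map_inv, h10]
      rw [hZ, ← h10, ← h10', ← map_mul, ← map_mul, ← map_mul, ← map_mul]
      congr 1
      ext a b
      simp only [elemSL_mul_apply, mul_elemSL_apply, elemSL_apply]
      grind
    have c5 := SpecialLinearGroup.entry_eq c4 2 0
    rw [ht] at c5
    simp [mul_assoc, elemSL_mul_apply, mul_elemSL_apply, elemSL_apply] at c5
    rw [ht, c5, elemSL_zero, mul_one]
  have hP : ∀ (i j : Fin 3) (hij : i ≠ j), (∀ x, ψ (elemSL i j x) = elemSL i j x) →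
      ψ (weylSL F i j hij) = weylSL F i j hij →
      ∀ x, ψ (elemSL j i x hij.symm) = elemSL j i x hij.symm := by
    intro i j hij h hw x
    have := congrArg ψ (elemSL_eq_conj_weylSL i j hij x)
    rw [map_mul, map_mul, hw, h, ← elemSL_eq_conj_weylSL] at this
    exact mul_right_cancel this
  have hw12 : ψ (weylSL F 1 2) = weylSL F 1 2 := by
    simp only [weylSL, map_mul, h12, h21]
  have h10' := hP 0 1 _ h01 hw01
  have h21' := hP 1 2 _ h12 hw12
  have h20' : ∀ x, ψ (elemSL 2 0 x) = elemSL 2 0 x := by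
    intro x
    have e := elemSL_mul_elemSL_comm 2 1 0 x 1 (by decide) (by decide) (by decide)
    have e' := congrArg ψ e
    simp only [map_mul, h10', h21', mul_one] at e' e
    exact (mul_right_cancel (e.symm.trans e')).symm
  have : MonoidHom.eqLocus ψ (MonoidHom.id _) = ⊤ := by
    refine eq_top_of_elemSL_mem _ fun i j hij x => ?_
    show ψ _ = _
    fin_cases i <;> fin_cases j <;> first | exact absurd rfl hij | skip
    exacts [h01 x, h02 x, h10' x, h12 x, h20' x, h21' x]
  ext1 X
  have hX : X ∈ MonoidHom.eqLocus ψ (MonoidHom.id _) := this ▸ Subgroup.mem_top X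
  exact hX

lemma exists_conj_of_map_elemSL [CharZero F]
    (ψ : SpecialLinearGroup (Fin 3) F →* SpecialLinearGroup (Fin 3) F)
    (h01 : ∀ x, ψ (elemSL 0 1 x) = elemSL 0 1 x) (h12 : ∀ x, ψ (elemSL 1 2 x) = elemSL 1 2 x)
    (h02 : ∀ x, ψ (elemSL 0 2 x) = elemSL 0 2 x) :
    ∃ k : F, ∀ X, ψ X = elemSL 0 2 k * X * (elemSL 0 2 k)⁻¹ := by
  obtain ⟨t, ht⟩ : ∃ t, ψ (elemSL 1 0 (-1)) = elemSL 1 2 t * elemSL 1 0 (-1) := by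
    obtain ⟨Z, hZ⟩ : ∃ Z, Z = ψ (elemSL 1 0 (-1)) := ⟨_, rfl⟩
    rw [← hZ]
    have c1 : Commute Z (elemSL 1 2 1) := by
      rw [hZ, ← h12]
      refine Commute.map ?_ ψ
      rw [commute_elemSL_iff one_ne_zero]
      simp only [elemSL_apply]
      grind
    have c2 : (elemSL 0 1 1 * (Z * elemSL 0 1 1)) * elemSL 0 2 1 =
        elemSL 1 2 (-1) * (elemSL 0 1 1 * (Z * elemSL 0 1 1)) := by
      rw [hZ, ← h01, ← h12, ← h02, ← map_mul, ← map_mul, ← map_mul, ← map_mul]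
      congr 1
      ext a b
      simp only [elemSL_mul_apply, mul_elemSL_apply, elemSL_apply]
      grind
    have c3 : Z * (elemSL 0 1 1 * (Z * elemSL 0 1 1)) =
        (elemSL 0 1 1 * (Z * elemSL 0 1 1)) * elemSL 0 1 1 := by
      rw [hZ, ← h01, ← map_mul, ← map_mul, ← map_mul, ← map_mul]
      congr 1
      ext a b
      simp only [elemSL_mul_apply, mul_elemSL_apply, elemSL_apply]
      grind
    refine ⟨Z 1 2, ?_⟩
    rw [commute_elemSL_iff one_ne_zero] at c1
    have c21 := SpecialLinearGroup.entry_eq c2 0 2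
    have c22 := SpecialLinearGroup.entry_eq c2 1 2
    have c31 := SpecialLinearGroup.entry_eq c3 0 1
    have c32 := SpecialLinearGroup.entry_eq c3 0 2
    rw [SpecialLinearGroup.mul_apply_three] at c31 c32
    simp only [elemSL_mul_apply, mul_elemSL_apply] at c21 c22 c31 c32
    obtain ⟨p1, p2, p3⟩ := c1
    have z01 := p1 0 (by decide)
    have z21 := p1 2 (by decide)
    have z20 := p2 0 (by decide)
    have hd := Z.det_coe
    rw [det_fin_three, z01, z21, z20] at hd
    simp [z01, z21, z20] at c21 c22 c31 c32
    have m1 : Z 2 2 = 1 := by grind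
    have hall : ∀ a : Fin 3, a = 0 ∨ a = 1 ∨ a = 2 := by decide
    ext a b
    simp only [elemSL_mul_apply, elemSL_apply]
    rcases hall a with rfl | rfl | rfl <;> rcases hall b with rfl | rfl | rfl <;> simp <;> grind
  have key : ((MulAut.conj (elemSL 0 2 (-t))).toMonoidHom.comp ψ) = MonoidHom.id _ := by
    apply eq_id_of_map_elemSL
    all_goals
      simp only [MonoidHom.comp_apply, MulEquiv.coe_toMonoidHom, MulAut.conj_apply, h01, h12, h02,
        ht, mul_inv_eq_iff_eq_mul]
      try intro x
      ext a b
      simp only [elemSL_mul_apply, mul_elemSL_apply, elemSL_apply]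
      grind
  refine ⟨t, fun X => ?_⟩
  have := DFunLike.congr_fun key X
  simp only [MonoidHom.comp_apply, MulEquiv.coe_toMonoidHom, MulAut.conj_apply,
    MonoidHom.id_apply] at this
  rw [show elemSL 0 2 t = (elemSL 0 2 (-t))⁻¹ by rw [SpecialLinearGroup.transvection_inv, neg_neg]]
  nth_rewrite 2 [← this]
  group

/-- Conjugation by an invertible matrix, as an automorphism of `SL(3,F)`. -/
def conjSL (g : GL (Fin 3) F) : SpecialLinearGroup (Fin 3) F ≃* SpecialLinearGroup (Fin 3) F where
  toFun X := ⟨g.val * X.val * g⁻¹.val, by rw [Matrix.det_units_conj]; exact X.2⟩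
  invFun X := ⟨g⁻¹.val * X.val * g.val, by
    have := Matrix.det_units_conj g⁻¹ X.val
    rw [inv_inv] at this
    rw [this]; exact X.2⟩
  left_inv X := Subtype.ext (by simp [Matrix.mul_assoc])
  right_inv X := Subtype.ext (by simp [Matrix.mul_assoc])
  map_mul' X Y := Subtype.ext (by
    show g.val * (X.val * Y.val) * g⁻¹.val = g.val * X.val * g⁻¹.val * (g.val * Y.val * g⁻¹.val)
    simp [Matrix.mul_assoc])

lemma conjSL_apply_eq_iff (g : GL (Fin 3) F) (X Y : SpecialLinearGroup (Fin 3) F) :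
    conjSL g X = Y ↔ g.val * X.val = Y.val * g.val := by
  refine Subtype.ext_iff.trans ?_
  show g.val * X.val * g⁻¹.val = Y.val ↔ _
  constructor
  · rintro h
    rw [← h]
    simp [Matrix.mul_assoc]
  · intro h
    rw [h]
    simp [Matrix.mul_assoc]

lemma conjSL_mul_apply (g h : GL (Fin 3) F) (X : SpecialLinearGroup (Fin 3) F) :
    conjSL (g * h) X = conjSL g (conjSL h X) := by
  apply Subtype.ext
  show (g * h).val * X.val * (g * h)⁻¹.val = g.val * (h.val * X.val * h⁻¹.val) * g⁻¹.val
  simp only [_root_.mul_inv_rev, Units.val_mul, Matrix.mul_assoc]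

lemma conjSL_coe_apply (s X : SpecialLinearGroup (Fin 3) F) :
    conjSL (s : GL (Fin 3) F) X = s * X * s⁻¹ := by
  rw [conjSL_apply_eq_iff]
  have h : s * X = s * X * s⁻¹ * s := by group
  exact congrArg Subtype.val h

lemma map_elemSL (f : F →+* F') (i j : Fin 3) (x : F) (hij : i ≠ j) :
    SpecialLinearGroup.map f (elemSL i j x hij) = elemSL i j (f x) hij := by
  ext a b
  show f (elemSL i j x hij a b) = _
  simp only [elemSL_apply]
  grind

lemma exists_ringEquiv_conj_of_map_elemSL [CharZero F] [CharZero F']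
    (φ : SpecialLinearGroup (Fin 3) F ≃* SpecialLinearGroup (Fin 3) F')
    {a b b' c : F'} (ha : a ≠ 0) (hc : c ≠ 0)
    (h01 : φ (elemSL 0 1 1) = elemSL 0 1 a * elemSL 0 2 b)
    (h12 : φ (elemSL 1 2 1) = elemSL 1 2 c * elemSL 0 2 b') :
    ∃ (α : F ≃+* F') (g : GL (Fin 3) F'), (g.val 1 0 = 0 ∧ g.val 2 0 = 0 ∧ g.val 2 1 = 0) ∧
      ∀ X, φ X = conjSL g (SpecialLinearGroup.map (α : F →+* F') X) := by
  let g₀ : GL (Fin 3) F' := GeneralLinearGroup.mkOfDetNeZero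
    !![a * c, b', 0; 0, c, -b / a; 0, 0, 1] (by simp [det_fin_three, ha, hc])
  have hg₀ : g₀.val = !![a * c, b', 0; 0, c, -b / a; 0, 0, 1] := rfl
  have k01 : conjSL g₀ (elemSL 0 1 1) = elemSL 0 1 a * elemSL 0 2 b := by
    rw [conjSL_apply_eq_iff, hg₀]
    ext i j
    rw [SpecialLinearGroup.val_mul, elemSL_coe, elemSL_coe, elemSL_coe]
    fin_cases i <;> fin_cases j <;>
      simp [mul_apply, Fin.sum_univ_three, single_apply, one_apply]
    all_goals field_simp
    all_goals ring
  have k12 : conjSL g₀ (elemSL 1 2 1) = elemSL 1 2 c * elemSL 0 2 b' := by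
    rw [conjSL_apply_eq_iff, hg₀]
    ext i j
    rw [SpecialLinearGroup.val_mul, elemSL_coe, elemSL_coe, elemSL_coe]
    fin_cases i <;> fin_cases j <;>
      simp [mul_apply, Fin.sum_univ_three, single_apply, one_apply]
    all_goals field_simp
    all_goals ring
  obtain ⟨α, hα⟩ := exists_ringEquiv_of_map_elemSL (φ.trans (conjSL g₀).symm)
    (by rw [MulEquiv.trans_apply, h01, ← k01, MulEquiv.symm_apply_apply])
    (by rw [MulEquiv.trans_apply, h12, ← k12, MulEquiv.symm_apply_apply])
  obtain ⟨k, hk⟩ := exists_conj_of_map_elemSL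
    (((φ.trans (conjSL g₀).symm).toMonoidHom).comp
      (SpecialLinearGroup.map (α.symm : F' →+* F)))
    (fun x => by simpa [map_elemSL] using (hα (α.symm x)).1)
    (fun x => by simpa [map_elemSL] using (hα (α.symm x)).2.1)
    (fun x => by simpa [map_elemSL] using (hα (α.symm x)).2.2)
  refine ⟨α, g₀ * (elemSL 0 2 k : SpecialLinearGroup (Fin 3) F'), ?_, fun X => ?_⟩
  · have hval : (g₀ * (elemSL 0 2 k : SpecialLinearGroup (Fin 3) F') : GL (Fin 3) F').val =
        g₀.val * (1 + single 0 2 k) := rfl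
    rw [hval, hg₀]
    simp [mul_apply, one_apply]
  · have h := hk (SpecialLinearGroup.map (α : F →+* F') X)
    have hX : SpecialLinearGroup.map (α.symm : F' →+* F)
        (SpecialLinearGroup.map (α : F →+* F') X) = X := by
      ext i j
      exact α.symm_apply_apply _
    rw [MonoidHom.comp_apply, hX] at h
    have h' : φ X = conjSL g₀ (elemSL 0 2 k * SpecialLinearGroup.map (α : F →+* F') X *
        (elemSL 0 2 k)⁻¹) := by
      rw [← h]
      exact ((conjSL g₀).apply_symm_apply _).symm
    rw [h', conjSL_mul_apply, conjSL_coe_apply]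

end Rigidity

section Antitranspose

variable {F : Type*} [Field F]

/-- The automorphism `X ↦ J (X⁻¹)ᵀ J` of `SL(3,F)`, where `J` is the antidiagonal permutation
matrix. -/
def antitransposeHom : SpecialLinearGroup (Fin 3) F →* SpecialLinearGroup (Fin 3) F where
  toFun X := ⟨(X⁻¹).valᵀ.submatrix Fin.revPerm Fin.revPerm, by
    rw [det_submatrix_equiv_self, det_transpose]; exact (X⁻¹).2⟩
  map_one' := by
    ext i j
    show (1 : SpecialLinearGroup (Fin 3) F)⁻¹ (Fin.rev j) (Fin.rev i) = _
    rw [inv_one]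
    simp [one_apply, eq_comm]
  map_mul' X Y := Subtype.ext (by
    show ((X * Y)⁻¹).valᵀ.submatrix _ _ =
      (X⁻¹).valᵀ.submatrix Fin.revPerm Fin.revPerm * (Y⁻¹).valᵀ.submatrix Fin.revPerm Fin.revPerm
    rw [submatrix_mul_equiv, ← transpose_mul, _root_.mul_inv_rev]
    rfl)

lemma antitransposeHom_apply (X : SpecialLinearGroup (Fin 3) F) (i j : Fin 3) :
    antitransposeHom X i j = X⁻¹ j.rev i.rev := rfl

lemma antitransposeHom_antitransposeHom (X : SpecialLinearGroup (Fin 3) F) :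
    antitransposeHom (antitransposeHom X) = X := by
  ext i j
  rw [antitransposeHom_apply, ← map_inv, antitransposeHom_apply, inv_inv, Fin.rev_rev, Fin.rev_rev]

/-- The automorphism `X ↦ J (X⁻¹)ᵀ J` of `SL(3,F)`. -/
def antitransposeSL : SpecialLinearGroup (Fin 3) F ≃* SpecialLinearGroup (Fin 3) F where
  toFun := antitransposeHom
  invFun := antitransposeHom
  left_inv := antitransposeHom_antitransposeHom
  right_inv := antitransposeHom_antitransposeHom
  map_mul' := map_mul _

lemma antitransposeSL_apply (X : SpecialLinearGroup (Fin 3) F) (i j : Fin 3) :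
    antitransposeSL X i j = X⁻¹ j.rev i.rev := rfl

lemma antitransposeSL_elemSL (i j : Fin 3) (hij : i ≠ j) (x : F) :
    antitransposeSL (elemSL i j x hij) = elemSL j.rev i.rev (-x) (by simpa using hij.symm) := by
  ext a b
  rw [antitransposeSL_apply, SpecialLinearGroup.transvection_inv, elemSL_apply, elemSL_apply]
  have : ∀ c d : Fin 3, c.rev = d ↔ c = d.rev := by decide
  simp only [this, Fin.rev_rev]
  grind

lemma map_antitransposeSL {F' : Type*} [Field F'] (f : F →+* F')
    (X : SpecialLinearGroup (Fin 3) F) :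
    SpecialLinearGroup.map f (antitransposeSL X) =
      antitransposeSL (SpecialLinearGroup.map f X) := by
  ext i j
  show f (X⁻¹ j.rev i.rev) = (SpecialLinearGroup.map f X)⁻¹ j.rev i.rev
  rw [← map_inv]
  rfl

lemma antitransposeSL_antitransposeSL (X : SpecialLinearGroup (Fin 3) F) :
    antitransposeSL (antitransposeSL X) = X :=
  antitransposeHom_antitransposeHom X

end Antitranspose

section Unitriangular

variable {F F' : Type} [Field F] [Field F']

lemma unitriSL_eq_elemSL_mul (a b c : ℤ) :
    unitriSL F a b c = elemSL 1 2 (c : F) * (elemSL 0 1 (a : F) * elemSL 0 2 (b : F)) := by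
  have h : ∀ i j, unitriSL F a b c i j = !![1, (a : F), (b : F); 0, 1, (c : F); 0, 0, 1] i j :=
    fun _ _ => rfl
  ext i j
  rw [h]
  simp only [elemSL_mul_apply, elemSL_apply]
  fin_cases i <;> fin_cases j <;> simp

lemma unitriSL_mem (a b c : ℤ) : unitriSL F a b c ∈ unitriSubgroup F := ⟨a, b, c, rfl⟩

lemma unitriSL_inj [CharZero F] {a b c a' b' c' : ℤ} :
    unitriSL F a b c = unitriSL F a' b' c' ↔ a = a' ∧ b = b' ∧ c = c' := by
  refine ⟨fun h => ?_, by rintro ⟨rfl, rfl, rfl⟩; rfl⟩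
  have e1 : (a : F) = a' := SpecialLinearGroup.entry_eq h 0 1
  have e2 : (b : F) = b' := SpecialLinearGroup.entry_eq h 0 2
  have e3 : (c : F) = c' := SpecialLinearGroup.entry_eq h 1 2
  exact_mod_cast And.intro e1 (And.intro e2 e3)

lemma commute_unitriSL_iff [CharZero F] {a b c a' b' c' : ℤ} :
    Commute (unitriSL F a b c) (unitriSL F a' b' c') ↔ a * c' = a' * c := by
  rw [commute_iff_eq, unitriSL_mul, unitriSL_mul, unitriSL_inj]
  grind

lemma sub_one_mul_sub_one_eq_zero {Y P : SpecialLinearGroup (Fin 3) F} {i j : Fin 3} {hij : i ≠ j}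
    {x : F} (h : Y * P = P * elemSL i j x hij) : (Y.val - 1) * (Y.val - 1) = 0 := by
  have h0 : Y.val * P.val = P.val * (1 + single i j x) := congrArg Subtype.val h
  have h1 : (Y.val - 1) * P.val = P.val * single i j x := by
    rw [sub_mul, h0]
    simp [mul_add]
  have h2 : (Y.val - 1) * (Y.val - 1) * P.val = 0 := by
    rw [Matrix.mul_assoc, h1, ← Matrix.mul_assoc, h1, Matrix.mul_assoc,
      single_mul_single_of_ne _ _ _ _ hij.symm, Matrix.mul_zero]
  have h3 : P.val * P⁻¹.val = 1 := congrArg Subtype.val (mul_inv_cancel P)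
  calc _ = (Y.val - 1) * (Y.val - 1) * P.val * P⁻¹.val := by
        rw [Matrix.mul_assoc _ P.val, h3, Matrix.mul_one]
    _ = 0 := by rw [h2, Matrix.zero_mul]

lemma mul_eq_zero_of_unitriSL_mul_eq [CharZero F] {a b c : ℤ} {P : SpecialLinearGroup (Fin 3) F}
    {i j : Fin 3} {hij : i ≠ j} {x : F}
    (h : unitriSL F a b c * P = P * elemSL i j x hij) : a * c = 0 := by
  have := congrFun (congrFun (sub_one_mul_sub_one_eq_zero h) 0) 2
  have h' : (unitriSL F a b c).val = !![1, (a : F), (b : F); 0, 1, (c : F); 0, 0, 1] := rfl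
  rw [h'] at this
  simp [mul_apply, Fin.sum_univ_three] at this
  simpa using this

lemma unitriSL_zero_right_inv (a b : ℤ) :
    (unitriSL F a b 0)⁻¹ = elemSL 0 1 (-(a : F)) * elemSL 0 2 (-(b : F)) := by
  rw [inv_eq_iff_mul_eq_one]
  ext i j
  simp only [← mul_assoc, mul_elemSL_apply]
  fin_cases i <;> fin_cases j <;> simp [unitriSL]

lemma unitriSL_zero_left_inv (b c : ℤ) :
    (unitriSL F 0 b c)⁻¹ = elemSL 1 2 (-(c : F)) * elemSL 0 2 (-(b : F)) := by
  rw [inv_eq_iff_mul_eq_one]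
  ext i j
  simp only [← mul_assoc, mul_elemSL_apply]
  fin_cases i <;> fin_cases j <;> simp [unitriSL]

/-- An isomorphism `SL(3,F) ≃* SL(3,F')` matching the integer unitriangular subgroups is, up to
the automorphism `antitransposeSL`, induced by a field isomorphism followed by conjugation by an
upper triangular matrix. -/
theorem exists_ringEquiv_conjSL_of_mem_unitriSubgroup_iff [CharZero F] [CharZero F']
    (φ : SpecialLinearGroup (Fin 3) F ≃* SpecialLinearGroup (Fin 3) F')
    (h : ∀ x, φ x ∈ unitriSubgroup F' ↔ x ∈ unitriSubgroup F) :
    ∃ (α : F ≃+* F') (g : GL (Fin 3) F'), (g.val 1 0 = 0 ∧ g.val 2 0 = 0 ∧ g.val 2 1 = 0) ∧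
      ((∀ X, φ X = conjSL g (SpecialLinearGroup.map (α : F →+* F') X)) ∨
        ∀ X, φ (antitransposeSL X) = conjSL g (SpecialLinearGroup.map (α : F →+* F') X)) := by
  have e01 : unitriSL F 1 0 0 = elemSL 0 1 1 := by
    simp [unitriSL_eq_elemSL_mul]
  have e12 : unitriSL F 0 0 1 = elemSL 1 2 1 := by
    simp [unitriSL_eq_elemSL_mul]
  have e02 : unitriSL F 0 1 0 = elemSL 0 2 1 := by
    simp [unitriSL_eq_elemSL_mul]
  obtain ⟨a₀, k, c₀, hk⟩ := (h _).2 (unitriSL_mem (F := F) 0 1 0)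
  obtain ⟨a, b, c, h01⟩ := (h _).2 (unitriSL_mem (F := F) 1 0 0)
  obtain ⟨a', b', c', h12⟩ := (h _).2 (unitriSL_mem (F := F) 0 0 1)
  have hcent : ∀ a b c : ℤ, Commute (unitriSL F' a₀ k c₀) (unitriSL F' a b c) := by
    intro a b c
    obtain ⟨a'', b'', c'', h'⟩ : φ.symm (unitriSL F' a b c) ∈ unitriSubgroup F := by
      rw [← h, φ.apply_symm_apply]
      exact unitriSL_mem a b c
    rw [← hk, ← φ.apply_symm_apply (unitriSL F' a b c), h']
    refine Commute.map ?_ φ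
    rw [commute_unitriSL_iff]
    simp
  obtain rfl : a₀ = 0 := by simpa [commute_unitriSL_iff] using hcent 0 0 1
  obtain rfl : c₀ = 0 := by simpa [commute_unitriSL_iff, eq_comm] using hcent 1 0 0
  have hk' : φ (elemSL 0 2 1) = elemSL 0 2 (k : F') := by
    rw [← e02, hk, unitriSL_eq_elemSL_mul]
    simp
  have hconj : ∀ Y P, Y * P = P * elemSL 0 2 1 → φ Y * φ P = φ P * elemSL 0 2 (k : F') := by
    intro Y P hYP
    rw [← hk', ← map_mul, hYP, map_mul]
  have hac : a * c = 0 := by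
    refine mul_eq_zero_of_unitriSL_mul_eq (h01 ▸ hconj _ (weylSL F 1 2) ?_)
    rw [e01]
    ext i j
    simp only [weylSL, elemSL_mul_apply, mul_elemSL_apply, elemSL_apply]
    grind
  have hac' : a' * c' = 0 := by
    refine mul_eq_zero_of_unitriSL_mul_eq (h12 ▸ hconj _ (weylSL F 1 0) ?_)
    rw [e12]
    ext i j
    simp only [weylSL, elemSL_mul_apply, mul_elemSL_apply, elemSL_apply]
    grind
  have hne : a * c' ≠ a' * c := by
    intro heq
    rw [← commute_unitriSL_iff (F := F') (b := b) (b' := b'), ← h01, ← h12] at heq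
    have := heq.map φ.symm
    rw [φ.symm_apply_apply, φ.symm_apply_apply, commute_unitriSL_iff] at this
    simp at this
  by_cases ha : a = 0
  · subst ha
    rw [zero_mul] at hne
    have ha' : a' ≠ 0 := left_ne_zero_of_mul hne.symm
    have hc : c ≠ 0 := right_ne_zero_of_mul hne.symm
    obtain rfl : c' = 0 := (mul_eq_zero.1 hac').resolve_left ha'
    obtain ⟨α, g, hg, hα⟩ := exists_ringEquiv_conj_of_map_elemSL (antitransposeSL.trans φ)
      (a := -(a' : F')) (b := -(b' : F')) (b' := -(b : F')) (c := -(c : F'))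
      (by simpa using ha') (by simpa using hc)
      (by
        have hinv : antitransposeSL (elemSL 0 1 (1 : F)) = (unitriSL F 0 0 1)⁻¹ := by
          rw [antitransposeSL_elemSL, e12, SpecialLinearGroup.transvection_inv]
        rw [MulEquiv.trans_apply, hinv, map_inv, h12, unitriSL_zero_right_inv])
      (by
        have hinv : antitransposeSL (elemSL 1 2 (1 : F)) = (unitriSL F 1 0 0)⁻¹ := by
          rw [antitransposeSL_elemSL, e01, SpecialLinearGroup.transvection_inv]
        rw [MulEquiv.trans_apply, hinv, map_inv, h01, unitriSL_zero_left_inv])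
    exact ⟨α, g, hg, Or.inr hα⟩
  · obtain rfl : c = 0 := (mul_eq_zero.1 hac).resolve_left ha
    rw [mul_zero] at hne
    have hc' : c' ≠ 0 := right_ne_zero_of_mul hne
    obtain rfl : a' = 0 := (mul_eq_zero.1 hac').resolve_right hc'
    obtain ⟨α, g, hg, hα⟩ := exists_ringEquiv_conj_of_map_elemSL φ
      (a := (a : F')) (b := (b : F')) (b' := (b' : F')) (c := (c' : F'))
      (by simpa using ha) (by simpa using hc')
      (by rw [← e01, h01, unitriSL_eq_elemSL_mul]; simp)
      (by rw [← e12, h12, unitriSL_eq_elemSL_mul]; simp)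
    exact ⟨α, g, hg, Or.inl hα⟩

end Unitriangular

section Amat

variable {F F' : Type} [Field F] [CharZero F] [Field F'] [CharZero F'] {q : ℚ} (hq : q ≠ 0)

lemma AmatSL_val : (AmatSL F q hq).val = !![1, 0, 0; 1, (q : F), 0; 1, 0, (q : F)⁻¹] := rfl

lemma AmatSL_inv_val :
    ((AmatSL F q hq)⁻¹).val =
      !![1, 0, 0; -(q : F)⁻¹, (q : F)⁻¹, 0; -(q : F), 0, (q : F)] := by
  have hq' : (q : F) ≠ 0 := by exact_mod_cast hq
  refine (Matrix.SpecialLinearGroup.coe_inv (AmatSL F q hq)).trans ?_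
  show adjugate !![1, 0, 0; 1, (q : F), 0; 1, 0, (q : F)⁻¹] = _
  rw [adjugate_fin_three]
  ext i j
  fin_cases i <;> fin_cases j <;> simp [hq']

lemma antitransposeSL_AmatSL_val :
    (antitransposeSL (AmatSL F q hq)).val =
      !![(q : F), 0, 0; 0, (q : F)⁻¹, 0; -(q : F), -(q : F)⁻¹, 1] := by
  ext i j
  rw [show (antitransposeSL (AmatSL F q hq)).val i j = ((AmatSL F q hq)⁻¹).val j.rev i.rev from rfl,
    AmatSL_inv_val]
  fin_cases i <;> fin_cases j <;> simp [Fin.rev]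

lemma map_AmatSL (f : F →+* F') :
    SpecialLinearGroup.map f (AmatSL F q hq) = AmatSL F' q hq := by
  apply Subtype.ext
  show f.mapMatrix (AmatSL F q hq).val = (AmatSL F' q hq).val
  rw [AmatSL_val, AmatSL_val]
  ext i j
  fin_cases i <;> fin_cases j <;> simp

/-- If an isomorphism `SL(3,F) ≃* SL(3,F')` matches the integer unitriangular subgroups and sends
`A` to `A` or `A⁻¹`, then it is induced by a field isomorphism. -/
theorem exists_ringEquiv_map_of_AmatSL (hq1 : q ≠ 1) (hqm1 : q ≠ -1)
    (φ : SpecialLinearGroup (Fin 3) F ≃* SpecialLinearGroup (Fin 3) F')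
    (h : ∀ x, φ x ∈ unitriSubgroup F' ↔ x ∈ unitriSubgroup F)
    (hA : φ (AmatSL F q hq) = AmatSL F' q hq ∨ φ (AmatSL F q hq) = (AmatSL F' q hq)⁻¹) :
    ∃ α : F ≃+* F', ∀ X, φ X = SpecialLinearGroup.map (α : F →+* F') X := by
  have hq' : (q : F') ≠ 0 := by exact_mod_cast hq
  have hqr : (q : F') ≠ (q : F')⁻¹ := by
    rw [Ne, ← mul_eq_one_iff_eq_inv₀ hq', mul_self_eq_one_iff, not_or]
    exact ⟨by exact_mod_cast hq1, by exact_mod_cast hqm1⟩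
  have hq1' : (q : F') ≠ 1 := by exact_mod_cast hq1
  have hqm1' : (q : F') ≠ -1 := by exact_mod_cast hqm1
  obtain ⟨α, g, ⟨h10, h20, h21⟩, hα⟩ := exists_ringEquiv_conjSL_of_mem_unitriSubgroup_iff φ h
  have hdet := g.isUnit.map (detMonoidHom (n := Fin 3) (R := F'))
  rw [coe_detMonoidHom, det_fin_three, h10, h20, h21] at hdet
  have hdet' : g.val 0 0 * g.val 1 1 * g.val 2 2 ≠ 0 := by simpa using hdet
  have h0 : g.val 0 0 ≠ 0 := left_ne_zero_of_mul (left_ne_zero_of_mul hdet')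
  have h1 : g.val 1 1 ≠ 0 := right_ne_zero_of_mul (left_ne_zero_of_mul hdet')
  have h2 : g.val 2 2 ≠ 0 := right_ne_zero_of_mul hdet'
  have hg := eta_fin_three g.val
  rw [h10, h20, h21] at hg
  clear hdet hdet' h10 h20 h21
  generalize g.val 0 0 = g0, g.val 1 1 = g1, g.val 2 2 = g2, g.val 0 1 = a, g.val 0 2 = b,
    g.val 1 2 = c at hg h0 h1 h2
  have hqq : (q : F') * (q : F')⁻¹ = 1 := mul_inv_cancel₀ hq'
  obtain hα | hα := hα
  · refine ⟨α, fun X => ?_⟩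
    rw [hα, map_AmatSL, conjSL_apply_eq_iff, conjSL_apply_eq_iff, AmatSL_inv_val, AmatSL_val,
      hg] at hA
    rw [hα, conjSL_apply_eq_iff, hg]
    suffices hs : g1 = g0 ∧ g2 = g0 ∧ a = 0 ∧ b = 0 ∧ c = 0 by
      obtain ⟨rfl, rfl, rfl, rfl, rfl⟩ := hs
      rw [show !![g2, 0, 0; 0, g2, 0; 0, 0, g2] = g2 • (1 : Matrix (Fin 3) (Fin 3) F') by
        ext i j; fin_cases i <;> fin_cases j <;> simp]
      simp
    clear hg hα h
    generalize (q : F')⁻¹ = r at *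
    generalize (q : F') = s at *
    simp at hA
    have hA' := hA.resolve_right (by
      rintro ⟨⟨hab, has, hbr⟩, ⟨-, hg1, -⟩, -⟩
      grind)
    grind
  · rw [← antitransposeSL_antitransposeSL (AmatSL F q hq), hα, map_antitransposeSL, map_AmatSL,
      conjSL_apply_eq_iff, conjSL_apply_eq_iff, AmatSL_inv_val, AmatSL_val,
      antitransposeSL_AmatSL_val, hg] at hA
    clear hg hα h
    generalize (q : F')⁻¹ = r at *
    generalize (q : F') = s at *
    simp at hA
    exfalso
    obtain hA | hA := hA
    · obtain ⟨-, ⟨hc, -, hcb⟩, hg2, -, hgb⟩ := hA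
      obtain rfl : c = g2 := mul_right_cancel₀ hq' (neg_injective (hc.trans hg2.symm))
      exact hqr (mul_right_cancel₀ h2 (add_left_cancel (hcb.symm.trans hgb)))
    · obtain ⟨⟨hb, -⟩, ⟨hc, -, hcb⟩, -⟩ := hA
      grind

end Amat

section AmatPowers

variable {F : Type} [Field F] [CharZero F] {q : ℚ} (hq : q ≠ 0)

lemma Rat.cast_zpow_eq_one_iff {F : Type*} [Field F] [CharZero F] {q : ℚ}
    (hq1 : q ≠ 1) (hqm1 : q ≠ -1) {k : ℤ} : (q : F) ^ k = 1 ↔ k = 0 := by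
  refine ⟨fun h => ?_, by rintro rfl; exact zpow_zero _⟩
  replace h : q ^ k = 1 := by exact_mod_cast h
  by_contra hk
  have h' : |q| ^ k = 1 := by rw [← abs_zpow, h, abs_one]
  rw [zpow_eq_one_iff_right₀ (abs_nonneg q) (by simp [abs_eq, hq1, hqm1])] at h'
  exact hk h'

lemma exists_AmatSL_zpow_val (k : ℤ) : ∃ x y : F,
    (AmatSL F q hq ^ k).val = !![1, 0, 0; x, (q : F) ^ k, 0; y, 0, ((q : F) ^ k)⁻¹] := by
  have hq' : (q : F) ≠ 0 := by exact_mod_cast hq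
  induction k using Int.induction_on with
  | zero =>
    refine ⟨0, 0, ?_⟩
    rw [zpow_zero]
    ext i j
    fin_cases i <;> fin_cases j <;> simp
  | succ k ih =>
    obtain ⟨x, y, h⟩ := ih
    refine ⟨x + (q : F) ^ (k : ℤ), y + ((q : F) ^ (k : ℤ))⁻¹, ?_⟩
    rw [_root_.zpow_add_one, SpecialLinearGroup.val_mul, h, AmatSL_val, zpow_add_one₀ hq', mul_inv]
    ext i j
    fin_cases i <;> fin_cases j <;> simp
  | pred k ih =>
    obtain ⟨x, y, h⟩ := ih
    refine ⟨x - (q : F) ^ (-k : ℤ) * (q : F)⁻¹, y - ((q : F) ^ (-k : ℤ))⁻¹ * q, ?_⟩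
    rw [_root_.zpow_sub_one, SpecialLinearGroup.val_mul, h, AmatSL_inv_val, zpow_sub_one₀ hq',
      mul_inv,
      inv_inv]
    ext i j
    fin_cases i <;> fin_cases j <;> simp [sub_eq_add_neg]

variable (hq1 : q ≠ 1) (hqm1 : q ≠ -1)
include hq1 hqm1

lemma AmatSL_zpow_injective : Function.Injective fun k : ℤ => AmatSL F q hq ^ k := by
  intro k l hkl
  obtain ⟨x, y, h⟩ := exists_AmatSL_zpow_val (F := F) hq (k - l)
  rw [_root_.zpow_sub, mul_inv_eq_one.2 hkl] at h
  have := congrFun (congrFun h 1) 1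
  exact sub_eq_zero.1
    ((Rat.cast_zpow_eq_one_iff (F := F) hq1 hqm1).1 (by simpa using this.symm))

lemma not_isConjSq_AmatSL_zpow (k : ℤ) : ¬ IsConjSq (AmatSL F q hq ^ k) := by
  rintro ⟨h1, g, hg⟩
  have hq' : (q : F) ^ k ≠ 0 := zpow_ne_zero _ (by exact_mod_cast hq)
  have hk : k ≠ 0 := by rintro rfl; exact h1 (zpow_zero _)
  obtain ⟨x, y, h⟩ := exists_AmatSL_zpow_val (F := F) hq k
  have htr : trace (AmatSL F q hq ^ k).val =
      trace ((AmatSL F q hq ^ k).val * (AmatSL F q hq ^ k).val) := by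
    rw [← SpecialLinearGroup.val_mul, ← pow_two, ← hg, SpecialLinearGroup.val_mul, trace_mul_comm,
      ← SpecialLinearGroup.val_mul, inv_mul_cancel_left]
  rw [h] at htr
  simp [trace_fin_three] at htr
  have h1' : q ^ k ≠ 1 := by
    have := (Rat.cast_zpow_eq_one_iff (F := ℚ) hq1 hqm1).not.2 hk
    simpa using this
  have h2 : (q ^ k) * (q ^ k)⁻¹ = 1 := mul_inv_cancel₀ (zpow_ne_zero _ hq)
  have h3 : 1 + q ^ k + (q ^ k)⁻¹ = 1 + q ^ k * q ^ k + (q ^ k)⁻¹ * (q ^ k)⁻¹ := by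
    exact_mod_cast htr
  generalize q ^ k = t at h1' h2 h3
  generalize t⁻¹ = r at h2 h3
  have h4 : (t + r - 2) * (t + r + 1) = 0 := by linear_combination -h3 + 2 * h2
  rcases mul_eq_zero.1 h4 with h5 | h5
  · exact h1' (sub_eq_zero.1 (pow_eq_zero_iff two_ne_zero |>.1
      (show (t - 1) ^ 2 = 0 by linear_combination t * h5 - h2)))
  · nlinarith [sq_nonneg (t + 1 / 2)]

lemma disjoint_unitriSubgroup_zpowers :
    Disjoint (unitriSubgroup F) (Subgroup.zpowers (AmatSL F q hq)) := by
  rw [Subgroup.disjoint_def]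
  rintro _ ⟨a, b, c, rfl⟩ ⟨k, hk⟩
  obtain ⟨x, y, h⟩ := exists_AmatSL_zpow_val (F := F) hq k
  simp only at hk
  rw [hk] at h
  have := congrFun (congrFun h 1) 1
  obtain rfl := (Rat.cast_zpow_eq_one_iff (F := F) hq1 hqm1).1
    (show (q : F) ^ k = 1 by simpa [unitriSL] using this.symm)
  rw [← hk, zpow_zero]

lemma conj_notMem_zpowers_AmatSL {u s : SpecialLinearGroup (Fin 3) F}
    (hu : u ∈ unitriSubgroup F) (hu1 : u ≠ 1) (hs : s ∈ Subgroup.zpowers (AmatSL F q hq))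
    (hs1 : s ≠ 1) : u⁻¹ * s * u ∉ Subgroup.zpowers (AmatSL F q hq) := by
  rintro ⟨l, hl⟩
  obtain ⟨k, rfl⟩ := hs
  obtain ⟨a, b, c, rfl⟩ := hu
  simp only at hl hs1
  have hk : k ≠ 0 := by rintro rfl; exact hs1 (zpow_zero _)
  have hl0 : l ≠ 0 := by
    rintro rfl
    rw [zpow_zero, eq_comm, mul_assoc, inv_mul_eq_one, eq_comm, mul_eq_right] at hl
    exact hs1 hl
  rw [mul_assoc, eq_inv_mul_iff_mul_eq] at hl
  obtain ⟨x, y, h⟩ := exists_AmatSL_zpow_val (F := F) hq k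
  obtain ⟨x', y', h'⟩ := exists_AmatSL_zpow_val (F := F) hq l
  have hm := congrArg Subtype.val hl
  rw [SpecialLinearGroup.val_mul, SpecialLinearGroup.val_mul, h, h',
    show (unitriSL F a b c).val = !![1, (a : F), (b : F); 0, 1, (c : F); 0, 0, 1] from rfl] at hm
  have hkk : (q : F) ^ (k + k) ≠ 1 := (Rat.cast_zpow_eq_one_iff hq1 hqm1).not.2 (by omega)
  have hll : (q : F) ^ l ≠ 1 := (Rat.cast_zpow_eq_one_iff hq1 hqm1).not.2 hl0
  have hq' : (q : F) ^ k ≠ 0 := zpow_ne_zero _ (by exact_mod_cast hq)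
  rw [zpow_add₀ (by exact_mod_cast hq)] at hkk
  simp at hm
  obtain ⟨⟨-, ha, hb⟩, ⟨-, hkl, hc⟩, -⟩ := hm
  obtain rfl : a = 0 := by
    by_contra ha'
    exact hll (mul_left_cancel₀ (Int.cast_ne_zero.2 ha') (ha.trans (mul_one _).symm))
  obtain rfl : b = 0 := by
    by_contra hb'
    exact hll (inv_eq_one.1
      (mul_left_cancel₀ (Int.cast_ne_zero.2 hb') (hb.trans (mul_one _).symm)))
  rw [Int.cast_zero, mul_zero, zero_add] at hkl hc
  rw [hkl, mul_inv_eq_iff_eq_mul₀ hq'] at hc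
  obtain rfl : c = 0 := by
    by_contra hc'
    refine hkk (mul_left_cancel₀ (Int.cast_ne_zero (α := F).2 hc') ?_)
    linear_combination -hc
  exact hu1 (by simp [unitriSL_eq_elemSL_mul])

end AmatPowers

/-- A pushout of two groups along injective maps is the amalgamated product of the factors. -/
theorem IsAmalgam.of_pushoutI {M : Bool → Type*} [∀ i, Group (M i)] {N : Type*} [Group N]
    {φ : ∀ i, N →* M i} (hφ : ∀ i, Function.Injective (φ i)) :
    IsAmalgam (fun i => (Monoid.PushoutI.of (φ := φ) i).range) (Monoid.PushoutI.base φ).range where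
  base_le i := by
    rintro _ ⟨n, rfl⟩
    exact ⟨φ i n, Monoid.PushoutI.of_apply_eq_base φ i n⟩
  letterProd_notMem l hl hne hmem := by
    obtain ⟨l', rfl⟩ : l ∈ Set.range
        (List.map fun s : Σ i, M i => (s.1, Monoid.PushoutI.of (φ := φ) s.1 s.2)) := by
      rw [Set.range_list_map]
      rintro ⟨i, _⟩ hp
      obtain ⟨m, hm⟩ := (hl.2 _ hp).1
      exact ⟨⟨i, m⟩, Prod.ext rfl hm⟩
    have hnot : ∀ s ∈ l', s.2 ∉ (φ s.1).range := by
      rintro s hs ⟨n, hn⟩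
      refine (hl.2 _ (List.mem_map_of_mem hs)).2 ⟨n, ?_⟩
      rw [← Monoid.PushoutI.of_apply_eq_base φ s.1, hn]
    let w : Monoid.CoprodI.Word M :=
      ⟨l', fun s hs h1 => hnot s hs (h1 ▸ one_mem _), (List.isChain_map fun s : Σ i, M i =>
        (s.1, Monoid.PushoutI.of (φ := φ) s.1 s.2)).1 hl.1⟩
    have hw : Monoid.PushoutI.Reduced φ w := hnot
    have hprod : Monoid.PushoutI.ofCoprodI w.prod = letterProd
        (l'.map fun s => (s.1, Monoid.PushoutI.of (φ := φ) s.1 s.2)) := by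
      simp [Monoid.CoprodI.Word.prod, letterProd, map_list_prod, Function.comp_def, w]
    have := hw.eq_empty_of_mem_range hφ (hprod ▸ hmem)
    refine hne (List.map_eq_nil_iff.2 ?_)
    exact congrArg Monoid.CoprodI.Word.toList this
  sup_eq_top := by
    rw [eq_top_iff]
    rintro x -
    induction x using Monoid.PushoutI.induction_on with
    | of i g =>
      cases i
      · exact Subgroup.mem_sup_left ⟨g, rfl⟩
      · exact Subgroup.mem_sup_right ⟨g, rfl⟩
    | base n =>
      rw [← Monoid.PushoutI.of_apply_eq_base φ false]
      exact Subgroup.mem_sup_left ⟨_, rfl⟩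
    | mul x y hx hy => exact mul_mem hx hy

/-- An automorphism carrying the range of one embedding onto the range of another induces an
isomorphism between the sources. -/
lemma exists_mulEquiv_of_mem_range_iff {M M' G : Type*} [Group M] [Group M'] [Group G]
    {f : M →* G} {f' : M' →* G} (hf : Function.Injective f) (hf' : Function.Injective f')
    (d : G ≃* G) (h : ∀ x, d x ∈ f'.range ↔ x ∈ f.range) :
    ∃ φ : M ≃* M', ∀ x, f' (φ x) = d (f x) := by
  choose φ hφ using fun x : M => (h (f x)).2 ⟨x, rfl⟩
  have hmul : ∀ x y, φ (x * y) = φ x * φ y := fun x y => hf' (by simp [hφ])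
  refine ⟨MulEquiv.ofBijective (MonoidHom.mk' φ hmul) ⟨fun x y hxy => ?_, fun y => ?_⟩, hφ⟩
  · exact hf (d.injective (by rw [← hφ, ← hφ]; exact congrArg f' hxy))
  · obtain ⟨x, hx⟩ := (h (d.symm (f' y))).1 (by rw [d.apply_symm_apply]; exact ⟨y, rfl⟩)
    exact ⟨x, hf' (by rw [MonoidHom.mk'_apply, hφ, hx, d.apply_symm_apply])⟩

/-- An isomorphism identifying two infinite cyclic subgroups sends generator to generator. -/
lemma eq_or_eq_inv_of_map_mem_zpowers {M M' : Type*} [Group M] [Group M'] {a : M} {b : M'}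
    (ha : Function.Injective fun k : ℤ => a ^ k) (φ : M ≃* M')
    (h : ∀ x, φ x ∈ Subgroup.zpowers b ↔ x ∈ Subgroup.zpowers a) : φ a = b ∨ φ a = b⁻¹ := by
  obtain ⟨k, hk⟩ := (h a).2 (Subgroup.mem_zpowers a)
  obtain ⟨l, hl⟩ := (h (φ.symm b)).1 (by
    rw [φ.apply_symm_apply]; exact Subgroup.mem_zpowers b)
  simp only at hk hl
  have hkl : l * k = 1 := ha (by
    apply φ.injective
    simp only
    rw [_root_.zpow_mul, hl, map_zpow, φ.apply_symm_apply, hk, zpow_one])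
  rcases Int.eq_one_or_neg_one_of_mul_eq_one (mul_comm l k ▸ hkl) with rfl | rfl
  · exact Or.inl (by rw [← hk, zpow_one])
  · exact Or.inr (by rw [← hk, _root_.zpow_neg_one])

section Amalgam

variable {K : Type} [Field K] [CharZero K] {q : ℚ} (hq : q ≠ 0)

lemma MonoidHom.comp_zpowersHom {M M' : Type*} [Group M] [Group M'] (f : M →* M') {a : M} {b : M'}
    (h : f a = b) : f.comp (zpowersHom M a) = zpowersHom M' b :=
  MonoidHom.ext_mint (by simp [h])

/-- Entrywise application of `α` on the second factor, as an endomorphism of the amalgam. -/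
def galoisEnd (α : K →+* K) : AmalGamma K q hq →* AmalGamma K q hq :=
  Monoid.PushoutI.lift
    (fun
      | false => amalInc K q hq false
      | true => (amalInc K q hq true).comp (SpecialLinearGroup.map α))
    (Monoid.PushoutI.base (sigmaMaps K q hq)) (by
      rintro (_ | _)
      · exact Monoid.PushoutI.of_comp_eq_base false
      · rw [← Monoid.PushoutI.of_comp_eq_base (φ := sigmaMaps K q hq) true]
        exact congrArg (amalInc K q hq true).comp
          (MonoidHom.comp_zpowersHom (SpecialLinearGroup.map α) (map_AmatSL hq α)))

lemma galoisEnd_amalInc_false (α : K →+* K) (x : SLfam K false) :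
    galoisEnd hq α (amalInc K q hq false x) = amalInc K q hq false x :=
  Monoid.PushoutI.lift_of _ _ _ x

lemma galoisEnd_amalInc_true (α : K →+* K) (x : SLfam K true) :
    galoisEnd hq α (amalInc K q hq true x) =
      amalInc K q hq true (SpecialLinearGroup.map α x) :=
  Monoid.PushoutI.lift_of _ _ _ x

lemma amalGamma_hom_ext {M : Type*} [Monoid M] {f g : AmalGamma K q hq →* M}
    (h : ∀ i x, f (amalInc K q hq i x) = g (amalInc K q hq i x)) : f = g :=
  Monoid.PushoutI.hom_ext_nonempty fun i => MonoidHom.ext (h i)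

lemma galoisEnd_comp (α β : K →+* K) :
    (galoisEnd hq α).comp (galoisEnd hq β) = galoisEnd hq (α.comp β) := by
  refine amalGamma_hom_ext hq ?_
  rintro (_ | _) x
  · simp only [MonoidHom.comp_apply, galoisEnd_amalInc_false]
  · simp only [MonoidHom.comp_apply, galoisEnd_amalInc_true]
    rfl

lemma galoisEnd_id : galoisEnd (K := K) hq (RingHom.id K) = MonoidHom.id _ := by
  refine amalGamma_hom_ext hq ?_
  rintro (_ | _) x
  · exact galoisEnd_amalInc_false hq _ x
  · exact galoisEnd_amalInc_true hq _ x

/-- The action of the automorphisms of `K` on the amalgam through the second factor. -/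
def galoisAut : (K ≃+* K) →* MulAut (AmalGamma K q hq) where
  toFun α := MonoidHom.toMulEquiv (galoisEnd hq (α : K →+* K)) (galoisEnd hq (α.symm : K →+* K))
    (by rw [galoisEnd_comp]; simp [galoisEnd_id]) (by rw [galoisEnd_comp]; simp [galoisEnd_id])
  map_one' := MulEquiv.ext fun x => DFunLike.congr_fun (galoisEnd_id hq) x
  map_mul' α β := MulEquiv.ext fun x =>
    DFunLike.congr_fun (galoisEnd_comp hq (α : K →+* K) (β : K →+* K)).symm x

lemma galoisAut_amalInc_false (α : K ≃+* K) (x : SLfam K false) :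
    galoisAut hq α (amalInc K q hq false x) = amalInc K q hq false x :=
  galoisEnd_amalInc_false hq (α : K →+* K) x

lemma galoisAut_amalInc_true (α : K ≃+* K) (x : SLfam K true) :
    galoisAut hq α (amalInc K q hq true x) =
      amalInc K q hq true (SpecialLinearGroup.map (α : K →+* K) x) :=
  galoisEnd_amalInc_true hq _ x

lemma map_unitriSL {F F' : Type} [Field F] [Field F'] (f : F →+* F') (a b c : ℤ) :
    SpecialLinearGroup.map f (unitriSL F a b c) = unitriSL F' a b c := by
  ext i j
  show f (unitriSL F a b c i j) = _
  fin_cases i <;> fin_cases j <;> simp [unitriSL]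

lemma galoisAut_of_mem_amalLambda (α : K ≃+* K) {x : AmalGamma K q hq}
    (hx : x ∈ amalLambda K q hq) : galoisAut hq α x = x := by
  suffices amalLambda K q hq ≤
      (galoisAut hq α).toMonoidHom.eqLocus (MonoidHom.id _) from this hx
  refine sup_le ?_ ?_
  · rintro _ ⟨y, -, rfl⟩
    exact galoisAut_amalInc_false hq α y
  · rintro _ ⟨_, ⟨a, b, c, rfl⟩, rfl⟩
    exact (galoisAut_amalInc_true hq α _).trans (congrArg _ (map_unitriSL (α : K →+* K) a b c))

/-- The homomorphism `(λ, α) ↦ Ad(λ) ∘ θ_α`. -/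
def lambdaGaloisHom : (amalLambda K q hq × (K ≃+* K)) →* MulAut (AmalGamma K q hq) :=
  (MulAut.conj.comp (amalLambda K q hq).subtype).noncommCoprod (galoisAut hq) fun l α =>
    MulEquiv.ext fun x => by
      show (l : AmalGamma K q hq) * galoisAut hq α x * (l : AmalGamma K q hq)⁻¹ =
        galoisAut hq α (l * x * (l : AmalGamma K q hq)⁻¹)
      rw [map_mul, map_mul, map_inv, galoisAut_of_mem_amalLambda hq α l.2]

lemma lambdaGaloisHom_apply (l : amalLambda K q hq) (α : K ≃+* K) (x : AmalGamma K q hq) :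
    lambdaGaloisHom hq (l, α) x =
      (l : AmalGamma K q hq) * galoisAut hq α x * (l : AmalGamma K q hq)⁻¹ := rfl

/-- The retraction of the amalgam onto its second factor. -/
def amalRetraction : AmalGamma K q hq →* SpecialLinearGroup (Fin 3) K :=
  Monoid.PushoutI.lift
    (fun
      | false => SpecialLinearGroup.map (algebraMap ℚ K)
      | true => MonoidHom.id (SpecialLinearGroup (Fin 3) K))
    (sigmaMaps K q hq true) (by
      rintro (_ | _)
      · exact MonoidHom.comp_zpowersHom (SpecialLinearGroup.map (algebraMap ℚ K))
          (map_AmatSL hq (algebraMap ℚ K))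
      · rfl)

lemma amalRetraction_amalInc_true (x : SLfam K true) :
    amalRetraction hq (amalInc K q hq true x) = x :=
  Monoid.PushoutI.lift_of _ _ _ x

lemma amalInc_mem_base_range_of_mem {i : Bool} {x : SLfam K i}
    (hx : x ∈ Subgroup.zpowers (AmatFam K q hq i)) :
    amalInc K q hq i x ∈ (Monoid.PushoutI.base (sigmaMaps K q hq)).range := by
  obtain ⟨k, rfl⟩ := hx
  exact ⟨Multiplicative.ofAdd k, (Monoid.PushoutI.of_apply_eq_base (sigmaMaps K q hq) i _).symm⟩

lemma exists_eq_amalInc_of_mem_base_range {x : AmalGamma K q hq}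
    (hx : x ∈ (Monoid.PushoutI.base (sigmaMaps K q hq)).range) (i : Bool) :
    ∃ k : ℤ, x = amalInc K q hq i (AmatFam K q hq i ^ k) := by
  obtain ⟨k, rfl⟩ := hx
  exact ⟨k.toAdd, (Monoid.PushoutI.of_apply_eq_base (sigmaMaps K q hq) i k).symm⟩

variable (hq1 : q ≠ 1) (hqm1 : q ≠ -1)
include hq1 hqm1

lemma AmatFam_zpow_injective (i : Bool) :
    Function.Injective fun k : ℤ => AmatFam K q hq i ^ k := by
  cases i
  · exact AmatSL_zpow_injective (F := ℚ) hq hq1 hqm1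
  · exact AmatSL_zpow_injective (F := K) hq hq1 hqm1

lemma sigmaMaps_injective (i : Bool) : Function.Injective (sigmaMaps K q hq i) := fun _ _ h =>
  Multiplicative.toAdd.injective (AmatFam_zpow_injective hq hq1 hqm1 i h)

lemma amalInc_injective (i : Bool) : Function.Injective (amalInc K q hq i) :=
  Monoid.PushoutI.of_injective (sigmaMaps_injective hq hq1 hqm1) i

lemma amalInc_mem_base_range_iff {i : Bool} {x : SLfam K i} :
    amalInc K q hq i x ∈ (Monoid.PushoutI.base (sigmaMaps K q hq)).range ↔
      x ∈ Subgroup.zpowers (AmatFam K q hq i) := by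
  refine ⟨fun h => ?_, amalInc_mem_base_range_of_mem hq⟩
  obtain ⟨k, hk⟩ := exists_eq_amalInc_of_mem_base_range hq h i
  exact ⟨k, (amalInc_injective hq hq1 hqm1 i hk).symm⟩

lemma isAmalgam_amalGamma : IsAmalgam (fun i => (amalInc K q hq i).range)
    (Monoid.PushoutI.base (sigmaMaps K q hq)).range :=
  IsAmalgam.of_pushoutI (sigmaMaps_injective hq hq1 hqm1)

lemma conj_notMem_base_range_of_isConjSq {x : AmalGamma K q hq} (hx : IsConjSq x)
    (h : AmalGamma K q hq) :
    h * x * h⁻¹ ∉ (Monoid.PushoutI.base (sigmaMaps K q hq)).range := by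
  intro hmem
  obtain ⟨k, hk⟩ := exists_eq_amalInc_of_mem_base_range hq hmem true
  obtain ⟨h1, g, hg⟩ := hk ▸ hx.conj h
  refine not_isConjSq_AmatSL_zpow (F := K) hq hq1 hqm1 k
    ⟨fun h' => h1 (h' ▸ map_one (amalInc K q hq true)), amalRetraction hq g, ?_⟩
  have := congrArg (amalRetraction hq) hg
  rwa [map_mul, map_mul, map_inv, map_pow, amalRetraction_amalInc_true] at this

lemma disjoint_unitriFam_map_base_range (i : Bool) :
    Disjoint ((unitriFam K i).map (amalInc K q hq i))
      (Monoid.PushoutI.base (sigmaMaps K q hq)).range := by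
  rw [Subgroup.disjoint_def]
  rintro _ ⟨x, hx, rfl⟩ hxT
  rw [amalInc_mem_base_range_iff hq hq1 hqm1] at hxT
  suffices x = 1 by rw [this, map_one]
  cases i
  · exact Subgroup.disjoint_def.1 (disjoint_unitriSubgroup_zpowers (F := ℚ) hq hq1 hqm1) hx hxT
  · exact Subgroup.disjoint_def.1 (disjoint_unitriSubgroup_zpowers (F := K) hq hq1 hqm1) hx hxT

lemma mem_unitriFam_of_amalInc_mem {i : Bool} {x : SLfam K i}
    (hx : amalInc K q hq i x ∈ amalLambda K q hq) : x ∈ unitriFam K i := by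
  obtain ⟨y, hy, hyx⟩ := (isAmalgam_amalGamma hq hq1 hqm1).mem_of_mem_sup
    (fun i => Subgroup.map_le_range _ _) (disjoint_unitriFam_map_base_range hq hq1 hqm1) hx ⟨x, rfl⟩
  rwa [← amalInc_injective hq hq1 hqm1 i hyx]

end Amalgam

lemma elemSL_mem_unitriSubgroup {F : Type} [Field F] : elemSL 0 2 (1 : F) ∈ unitriSubgroup F :=
  ⟨0, 1, 0, by simp [unitriSL_eq_elemSL_mul]⟩

lemma elemSL_injective_map {F F' : Type} [Field F] [Field F'] {f g : F →+* F'}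
    (h : SpecialLinearGroup.map (n := Fin 3) f = SpecialLinearGroup.map g) : f = g := by
  ext x
  have := DFunLike.congr_fun h (elemSL 0 1 x)
  rw [map_elemSL, map_elemSL] at this
  exact elemSL_inj.1 this

/-- The element `1 + E₁₃` of each factor. -/
def elemFam (K : Type) [Field K] : (i : Bool) → SLfam K i
  | false => elemSL 0 2 (1 : ℚ)
  | true => elemSL 0 2 (1 : K)

lemma elemFam_mem {K : Type} [Field K] (i : Bool) : elemFam K i ∈ unitriFam K i := by
  cases i
  · exact elemSL_mem_unitriSubgroup (F := ℚ)
  · exact elemSL_mem_unitriSubgroup (F := K)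

section Automorphisms

variable {K : Type} [Field K] [CharZero K] {q : ℚ} (hq : q ≠ 0)

lemma isConjSq_elemFam (i : Bool) : IsConjSq (elemFam K i) := by
  cases i
  · exact isConjSq_elemSL (F := ℚ) (i := 0) (j := 2) (hij := by decide) one_ne_zero
  · exact isConjSq_elemSL (F := K) (i := 0) (j := 2) (hij := by decide) one_ne_zero

lemma eq_top_of_elemFam_mem {i : Bool} (P : Subgroup (SLfam K i)) (h : elemFam K i ∈ P)
    (hc : ∀ x ∈ P, IsConjSq x → ∀ y, Commute y x → y ∈ P) : P = ⊤ := by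
  cases i
  · exact eq_top_of_elemSL_mem_of_commute (F := ℚ) P h hc
  · exact eq_top_of_elemSL_mem_of_commute (F := K) P h hc

lemma map_amalInc_le_amalLambda (i : Bool) :
    (unitriFam K i).map (amalInc K q hq i) ≤ amalLambda K q hq := by
  cases i
  · exact le_sup_left
  · exact le_sup_right

variable (hq1 : q ≠ 1) (hqm1 : q ≠ -1)
include hq1 hqm1

lemma conj_notMem_zpowers_AmatFam {i : Bool} {u s : SLfam K i} (hu : u ∈ unitriFam K i)
    (hu1 : u ≠ 1) (hs : s ∈ Subgroup.zpowers (AmatFam K q hq i)) (hs1 : s ≠ 1) :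
    u⁻¹ * s * u ∉ Subgroup.zpowers (AmatFam K q hq i) := by
  cases i
  · exact conj_notMem_zpowers_AmatSL (F := ℚ) hq hq1 hqm1 hu hu1 hs hs1
  · exact conj_notMem_zpowers_AmatSL (F := K) hq hq1 hqm1 hu hu1 hs hs1

/-- An automorphism of the amalgam preserving `Λ` and carrying one factor onto another induces
an isomorphism between these factors matching the integer unitriangular subgroups. -/
lemma exists_mulEquiv_SLfam {i j : Bool} (d : AmalGamma K q hq ≃* AmalGamma K q hq)
    (hd : ∀ x, d x ∈ amalLambda K q hq ↔ x ∈ amalLambda K q hq)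
    (hij : ∀ x, d x ∈ (amalInc K q hq j).range ↔ x ∈ (amalInc K q hq i).range) :
    ∃ φ : SLfam K i ≃* SLfam K j, (∀ x, amalInc K q hq j (φ x) = d (amalInc K q hq i x)) ∧
      ∀ x, φ x ∈ unitriFam K j ↔ x ∈ unitriFam K i := by
  obtain ⟨φ, hφ⟩ := exists_mulEquiv_of_mem_range_iff (amalInc_injective hq hq1 hqm1 i)
    (amalInc_injective hq hq1 hqm1 j) d hij
  refine ⟨φ, hφ, fun x => ⟨fun h => ?_, fun h => ?_⟩⟩
  · apply mem_unitriFam_of_amalInc_mem hq hq1 hqm1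
    rw [← hd, ← hφ]
    exact map_amalInc_le_amalLambda hq j ⟨_, h, rfl⟩
  · apply mem_unitriFam_of_amalInc_mem hq hq1 hqm1
    rw [hφ, hd]
    exact map_amalInc_le_amalLambda hq i ⟨_, h, rfl⟩

lemma not_swap_of_not_surjective (hKQ : ¬ Function.Surjective ((↑) : ℚ → K))
    (d : AmalGamma K q hq ≃* AmalGamma K q hq)
    (hd : ∀ x, d x ∈ amalLambda K q hq ↔ x ∈ amalLambda K q hq) :
    ¬ ∀ x, d x ∈ (amalInc K q hq true).range ↔ x ∈ (amalInc K q hq false).range := by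
  intro h
  obtain ⟨φ, -, hφ⟩ := exists_mulEquiv_SLfam hq hq1 hqm1 d hd h
  obtain ⟨α, -⟩ := exists_ringEquiv_conjSL_of_mem_unitriSubgroup_iff (F := ℚ) (F' := K) φ hφ
  refine hKQ fun x => ⟨α.symm x, ?_⟩
  rw [← eq_ratCast α, α.apply_symm_apply]

lemma exists_conj_mem_range_iff (hKQ : ¬ Function.Surjective ((↑) : ℚ → K))
    (d : AmalGamma K q hq ≃* AmalGamma K q hq)
    (hd : ∀ x, d x ∈ amalLambda K q hq ↔ x ∈ amalLambda K q hq) :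
    ∃ g ∈ amalLambda K q hq, ∀ i x,
      g * d x * g⁻¹ ∈ (amalInc K q hq i).range ↔ x ∈ (amalInc K q hq i).range := by
  have hinj := amalInc_injective (K := K) hq hq1 hqm1
  refine (isAmalgam_amalGamma hq hq1 hqm1).exists_conj_map_eq_of_forall_ne
    (L := fun i => (unitriFam K i).map (amalInc K q hq i))
    (z := fun i => amalInc K q hq i (elemFam K i))
    (fun i => Subgroup.map_le_range _ _) (disjoint_unitriFam_map_base_range hq hq1 hqm1)
    (fun x => conj_notMem_base_range_of_isConjSq hq hq1 hqm1)
    (fun i => ⟨_, elemFam_mem i, rfl⟩) (fun i => (isConjSq_elemFam i).map _ (hinj i))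
    (fun i P hz hP => ?_) (fun i u hu hu1 s hs hs1 => ?_) ?_ d hd (fun g hg => ?_)
  · rw [MonoidHom.range_eq_map, Subgroup.map_le_iff_le_comap, top_le_iff]
    exact eq_top_of_elemFam_mem _ hz fun x hx hsq y hy =>
      hP _ hx (hsq.map _ (hinj i)) _ (hy.map _)
  · obtain ⟨u, hu, rfl⟩ := hu
    obtain ⟨k, rfl⟩ := exists_eq_amalInc_of_mem_base_range hq hs i
    rw [← map_inv, ← map_mul, ← map_mul, amalInc_mem_base_range_iff hq hq1 hqm1]
    refine conj_notMem_zpowers_AmatFam hq hq1 hqm1 hu ?_ ⟨k, rfl⟩ ?_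
    · rintro rfl
      exact hu1 (map_one _)
    · intro h
      exact hs1 (h ▸ map_one _)
  · intro h
    have hmem := amalInc_mem_base_range_of_mem hq (Subgroup.mem_zpowers (AmatFam K q hq true))
    rw [h, Subgroup.mem_bot, ← map_one (amalInc K q hq true)] at hmem
    refine one_ne_zero (AmatFam_zpow_injective (K := K) hq hq1 hqm1 true ?_)
    simpa using hinj true hmem
  · exact not_swap_of_not_surjective hq hq1 hqm1 hKQ (d.trans (MulAut.conj g)) fun x => by
      rw [← hd x]
      exact (Subgroup.mul_mem_cancel_right _ (inv_mem hg)).trans (Subgroup.mul_mem_cancel_left _ hg)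

lemma mem_base_range_iff (x : AmalGamma K q hq) :
    x ∈ (Monoid.PushoutI.base (sigmaMaps K q hq)).range ↔
      x ∈ (amalInc K q hq false).range ∧ x ∈ (amalInc K q hq true).range := by
  rw [← Subgroup.mem_inf]
  exact (Monoid.PushoutI.inf_of_range_eq_base_range (sigmaMaps_injective (K := K) hq hq1 hqm1)
    Bool.false_ne_true).symm ▸ Iff.rfl

/-- An automorphism preserving `Λ` and both factors comes from an automorphism of `K`. -/
lemma exists_eq_galoisAut (d : MulAut (AmalGamma K q hq))
    (hd : ∀ x, d x ∈ amalLambda K q hq ↔ x ∈ amalLambda K q hq)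
    (hi : ∀ i x, d x ∈ (amalInc K q hq i).range ↔ x ∈ (amalInc K q hq i).range) :
    ∃ α : K ≃+* K, d = galoisAut hq α := by
  have hbase : ∀ x, d x ∈ (Monoid.PushoutI.base (sigmaMaps K q hq)).range ↔
      x ∈ (Monoid.PushoutI.base (sigmaMaps K q hq)).range := fun x => by
    rw [mem_base_range_iff hq hq1 hqm1, mem_base_range_iff hq hq1 hqm1, hi, hi]
  choose φ hφ hu using fun i => exists_mulEquiv_SLfam hq hq1 hqm1 d hd (hi i)
  have hA : ∀ i, φ i (AmatFam K q hq i) = AmatFam K q hq i ∨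
      φ i (AmatFam K q hq i) = (AmatFam K q hq i)⁻¹ := fun i => by
    refine eq_or_eq_inv_of_map_mem_zpowers (AmatFam_zpow_injective (K := K) hq hq1 hqm1 i)
      (b := AmatFam K q hq i) (φ i) fun x => ?_
    rw [← amalInc_mem_base_range_iff hq hq1 hqm1, ← amalInc_mem_base_range_iff hq hq1 hqm1, hφ,
      hbase]
  obtain ⟨β, hβ⟩ := exists_ringEquiv_map_of_AmatSL (F := ℚ) (F' := ℚ) hq hq1 hqm1 (φ false)
    (hu false) (hA false)
  obtain ⟨α, hα⟩ := exists_ringEquiv_map_of_AmatSL (F := K) (F' := K) hq hq1 hqm1 (φ true)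
    (hu true) (hA true)
  refine ⟨α, MulEquiv.toMonoidHom_injective (amalGamma_hom_ext hq ?_)⟩
  rintro (_ | _) x
  · refine (hφ false x).symm.trans ((congrArg _ ((hβ x).trans ?_)).trans
      (galoisAut_amalInc_false hq α x).symm)
    rw [Subsingleton.elim (β : ℚ →+* ℚ) (RingHom.id ℚ)]
    rfl
  · exact (hφ true x).symm.trans ((congrArg _ (hα x)).trans (galoisAut_amalInc_true hq α x).symm)

lemma lambdaGaloisHom_injective : Function.Injective (lambdaGaloisHom (K := K) hq) := by
  rw [injective_iff_map_eq_one]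
  rintro ⟨⟨l, hl⟩, α⟩ h
  have hx : ∀ x, l * galoisAut hq α x * l⁻¹ = x := fun x => DFunLike.congr_fun h x
  have hA := isAmalgam_amalGamma (K := K) hq hq1 hqm1
  have hinj := amalInc_injective (K := K) hq hq1 hqm1
  have hmem : ∀ i, l ∈ (amalInc K q hq i).range := fun i => by
    refine hA.mem_of_commute (i := i) (x := amalInc K q hq i (elemFam K i)) ⟨_, rfl⟩
      (conj_notMem_base_range_of_isConjSq hq hq1 hqm1 ((isConjSq_elemFam i).map _ (hinj i))) ?_
    have := hx (amalInc K q hq i (elemFam K i))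
    rwa [galoisAut_of_mem_amalLambda hq α
      (map_amalInc_le_amalLambda hq i ⟨_, elemFam_mem i, rfl⟩), mul_inv_eq_iff_eq_mul] at this
  obtain rfl : l = 1 := by
    refine Subgroup.disjoint_def.1 (disjoint_unitriFam_map_base_range hq hq1 hqm1 true) ?_
      ((mem_base_range_iff hq hq1 hqm1 l).2 ⟨hmem false, hmem true⟩)
    obtain ⟨y, rfl⟩ := hmem true
    exact ⟨y, mem_unitriFam_of_amalInc_mem hq hq1 hqm1 hl, rfl⟩
  obtain rfl : α = 1 := by
    refine RingEquiv.toRingHom_injective (elemSL_injective_map (MonoidHom.ext fun y => ?_))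
    refine hinj true ?_
    refine (galoisAut_amalInc_true hq α y).symm.trans ?_
    have := hx (amalInc K q hq true y)
    rw [one_mul, inv_one, mul_one] at this
    exact this
  rfl

end Automorphisms

/-- With `Γ = SL(3,ℚ) *_Σ SL(3,K)` and `Λ = Λ₁ * Λ₂` as above: the map
`(λ, α) ↦ Ad(λ) ∘ θ_α` — where `θ_α` is the automorphism of `Γ` which is the identity on
`SL(3,ℚ)` and entrywise application of `α` on `SL(3,K)` — is an injective group
homomorphism `Λ × Aut(K) → Aut(Γ)` whose image is exactly
`Aut(Λ < Γ) = {δ ∈ Aut(Γ) : δ(Λ) = Λ}`. -/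
theorem aut_lambda_gamma_iso_lambda_prod_galois
    (K : Type) [Field K] [CharZero K] [Countable K]
    (hKQ : ¬ Function.Surjective ((↑) : ℚ → K))
    (q : ℚ) (hq0 : q ≠ 0) (hq1 : q ≠ 1) (hqm1 : q ≠ -1) :
    ∃ F : (amalLambda K q hq0 × (K ≃+* K)) →* MulAut (AmalGamma K q hq0),
      Function.Injective F ∧
      (∀ (l : amalLambda K q hq0) (α : K ≃+* K),
        (∀ x : SLfam K false,
          F (l, α) (amalInc K q hq0 false x)
            = (l : AmalGamma K q hq0) * amalInc K q hq0 false x * (l : AmalGamma K q hq0)⁻¹) ∧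
        (∀ y : SLfam K true,
          F (l, α) (amalInc K q hq0 true y)
            = (l : AmalGamma K q hq0) *
                amalInc K q hq0 true (Matrix.SpecialLinearGroup.map (α : K →+* K) y) *
                (l : AmalGamma K q hq0)⁻¹)) ∧
      (∀ d : MulAut (AmalGamma K q hq0),
        d ∈ Set.range F ↔
          Subgroup.map d.toMonoidHom (amalLambda K q hq0) = amalLambda K q hq0) := by
  refine ⟨lambdaGaloisHom hq0, lambdaGaloisHom_injective hq0 hq1 hqm1, fun l α =>
    ⟨fun x => ?_, fun y => ?_⟩, fun d => ⟨?_, fun hd => ?_⟩⟩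
  · rw [lambdaGaloisHom_apply, galoisAut_amalInc_false]
  · rw [lambdaGaloisHom_apply, galoisAut_amalInc_true]
  · rintro ⟨⟨l, α⟩, rfl⟩
    refine le_antisymm ?_ fun x hx => ⟨(l : AmalGamma K q hq0)⁻¹ * x * l,
      mul_mem (mul_mem (inv_mem l.2) hx) l.2, ?_⟩
    · rintro _ ⟨x, hx, rfl⟩
      show lambdaGaloisHom hq0 (l, α) x ∈ _
      rw [lambdaGaloisHom_apply, galoisAut_of_mem_amalLambda hq0 α hx]
      exact mul_mem (mul_mem l.2 hx) (inv_mem l.2)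
    · show lambdaGaloisHom hq0 (l, α) _ = x
      rw [lambdaGaloisHom_apply, galoisAut_of_mem_amalLambda hq0 α
        (mul_mem (mul_mem (inv_mem l.2) hx) l.2)]
      group
  · have hd' : ∀ x, d x ∈ amalLambda K q hq0 ↔ x ∈ amalLambda K q hq0 := fun x => by
      conv_lhs => rw [← hd]
      exact Subgroup.mem_map_iff_mem d.injective
    obtain ⟨g, hg, hgi⟩ := exists_conj_mem_range_iff hq0 hq1 hqm1 hKQ d hd'
    obtain ⟨α, hα⟩ := exists_eq_galoisAut hq0 hq1 hqm1 (MulAut.conj g * d) (fun x => by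
      rw [← hd' x]
      exact (Subgroup.mul_mem_cancel_right _ (inv_mem hg)).trans
        (Subgroup.mul_mem_cancel_left _ hg)) hgi
    refine ⟨(⟨g, hg⟩⁻¹, α), MulEquiv.ext fun x => ?_⟩
    rw [lambdaGaloisHom_apply, ← hα]
    simp [mul_assoc]
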